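/- arXiv:1906.11650 — 2 statements merged into one kernel-verified Lean document; each statement's English description precedes it below -/
import Mathlib

section
/- Let F be a field with at least 4 elements, let χ : G_F → {±1} be a character, and let x ∈ F^× satisfy χ(x) = −1. Then 2·[x]_χ = 2·χ(x−1)·C_F in RP′(F)_χ. -/
open scoped Classical

noncomputable section

variable (F : Type) [Field F]

/-- The group of square classes `G_F = F^× / (F^×)²`. -/
def SqCl (F : Type) [Field F] : Type :=
  Fˣ ⧸ (powMonoidHom 2 : Fˣ →* Fˣ).range

instance : CommGroup (SqCl F) := QuotientGroup.Quotient.commGroup _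

/-- The square class of a unit. -/
def sqc : Fˣ →* SqCl F := QuotientGroup.mk' _

/-- The group ring `R_F = ℤ[F^×/(F^×)²]`. -/
abbrev RF (F : Type) [Field F] : Type := MonoidAlgebra ℤ (SqCl F)

/-- `⟨x⟩ ∈ R_F`, the square class of a unit as an element of the group ring. -/
def cls (x : Fˣ) : RF F := MonoidAlgebra.of ℤ (SqCl F) (sqc F x)

/-- The free `R_F`-module on the set `F^×`. -/
abbrev FreeRP (F : Type) [Field F] : Type := Fˣ →₀ RF F

/-- The generator `[x]` of the free module. -/
def gen (x : Fˣ) : FreeRP F := Finsupp.single x 1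

/-- units from nonzero field elements -/
def U (x : F) (h : x ≠ 0) : Fˣ := Units.mk0 x h

variable {F}

theorem one_sub_ne {x : Fˣ} (hx : (x : F) ≠ 1) : (1 : F) - x ≠ 0 :=
  sub_ne_zero.mpr (Ne.symm hx)

theorem inv_sub_one_ne {x : Fˣ} (hx : (x : F) ≠ 1) : ((x : F)⁻¹ - 1) ≠ 0 :=
  sub_ne_zero.mpr (fun h => hx (by rwa [inv_eq_one] at h))

theorem one_sub_inv_ne {x : Fˣ} (hx : (x : F) ≠ 1) : (1 - (x : F)⁻¹) ≠ 0 :=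
  sub_ne_zero.mpr (fun h => hx (by rw [eq_comm, inv_eq_one] at h; exact h.symm ▸ rfl))

variable (F)

/-- The five term relation `S_{x,y}` as an element of the free module. -/
def FT (x y : Fˣ) (hx : (x : F) ≠ 1) (hy : (y : F) ≠ 1) : FreeRP F :=
  gen F x - gen F y + cls F x • gen F (y * x⁻¹)
    - cls F (U F ((x : F)⁻¹ - 1) (inv_sub_one_ne hx)) •
        gen F (U F ((1 - (x : F)⁻¹) / (1 - (y : F)⁻¹))
          (div_ne_zero (one_sub_inv_ne hx) (one_sub_inv_ne hy)))
    + cls F (U F (1 - (x : F)) (one_sub_ne hx)) •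
        gen F (U F ((1 - (x : F)) / (1 - (y : F)))
          (div_ne_zero (one_sub_ne hx) (one_sub_ne hy)))

/-- The set of five-term relations. -/
def ftRels : Set (FreeRP F) :=
  {w | ∃ (x y : Fˣ) (hx : (x : F) ≠ 1) (hy : (y : F) ≠ 1), w = FT F x y hx hy}

/-- The relations `ψ₁(x) = [x] + ⟨-1⟩[x⁻¹]`. -/
def psiRels : Set (FreeRP F) :=
  {w | ∃ x : Fˣ, w = gen F x + cls F (-1) • gen F x⁻¹}

/-- relations `⟨-1⟩[x] = [x]` -/
def minusRels : Set (FreeRP F) :=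
  {w | ∃ x : Fˣ, w = cls F (-1) • gen F x - gen F x}

/-- relations `[x⁻¹] = -[x]` -/
def invRels : Set (FreeRP F) :=
  {w | ∃ x : Fˣ, w = gen F x⁻¹ + gen F x}

/-- The module `qRP(F) = RP(F)/⟨ψ₁(x) : x ∈ F^×⟩`. -/
def qRP : Type := FreeRP F ⧸ Submodule.span (RF F) (ftRels F ∪ psiRels F)

instance : AddCommGroup (qRP F) := by unfold qRP; infer_instance
instance : Module (RF F) (qRP F) := by unfold qRP; infer_instance

/-- `[x] ∈ qRP(F)` -/
def qrp (x : Fˣ) : qRP F := Submodule.Quotient.mk (gen F x)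

/-- The module `RP′(F)`. -/
def RP' : Type :=
  FreeRP F ⧸ Submodule.span (RF F)
    ({gen F 1} ∪ ftRels F ∪ minusRels F ∪ invRels F)

instance : AddCommGroup (RP' F) := by unfold RP'; infer_instance
instance : Module (RF F) (RP' F) := by unfold RP'; infer_instance

/-- `[x] ∈ RP′(F)` -/
def rp (x : Fˣ) : RP' F := Submodule.Quotient.mk (gen F x)

/-- the submodule of `M` generated by the elements `(⟨a⟩ - χ(a))·m`. -/
def chiSub (χ : SqCl F →* ℤˣ) (M : Type) [AddCommGroup M] [Module (RF F) M] :
    Submodule (RF F) M :=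
  Submodule.span (RF F)
    {w | ∃ (a : Fˣ) (m : M), w = cls F a • m - ((χ (sqc F a) : ℤ)) • m}

/-- `M_χ` -/
def ChiQuot (χ : SqCl F →* ℤˣ) (M : Type) [AddCommGroup M] [Module (RF F) M] : Type :=
  M ⧸ chiSub F χ M

instance (χ : SqCl F →* ℤˣ) (M : Type) [AddCommGroup M] [Module (RF F) M] :
    AddCommGroup (ChiQuot F χ M) := by unfold ChiQuot; infer_instance
instance (χ : SqCl F →* ℤˣ) (M : Type) [AddCommGroup M] [Module (RF F) M] :
    Module (RF F) (ChiQuot F χ M) := by unfold ChiQuot; infer_instance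

/-- image of `m` in `M_χ` -/
def mkChi (χ : SqCl F →* ℤˣ) {M : Type} [AddCommGroup M] [Module (RF F) M] (m : M) :
    ChiQuot F χ M := Submodule.Quotient.mk m

/-- `M[1/2]`, as an `R_F`-module (localization at the powers of `2`). -/
def Loc2 (M : Type) [AddCommGroup M] [Module (RF F) M] : Type :=
  LocalizedModule (Submonoid.powers (2 : RF F)) M

instance (M : Type) [AddCommGroup M] [Module (RF F) M] : AddCommGroup (Loc2 F M) := by
  unfold Loc2; infer_instance
instance (M : Type) [AddCommGroup M] [Module (RF F) M] : Module (RF F) (Loc2 F M) := by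
  unfold Loc2; infer_instance

/-- the canonical map `M → M[1/2]` -/
def toLoc2 {M : Type} [AddCommGroup M] [Module (RF F) M] (m : M) : Loc2 F M :=
  LocalizedModule.mkLinearMap (Submonoid.powers (2 : RF F)) M m


/-- the square class of a field element (junk value `1` at `0`). -/
def sqv (a : F) : SqCl F := if h : a ≠ 0 then sqc F (U F a h) else 1

/-- `[a] ∈ RP′(F)` for a field element `a`, where `[0]` is assigned the value `c₀`. -/
def rpc (c₀ : RP' F) (a : F) : RP' F := if h : a ≠ 0 then rp F (U F a h) else c₀

end

namespace S4

noncomputable def g (F : Type) [Field F] (χ : SqCl F →* ℤˣ) (a : F) : ChiQuot F χ (RP' F) :=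
  if h : a ≠ 0 then mkChi F χ (rp F (U F a h)) else 0

noncomputable def s (F : Type) [Field F] (χ : SqCl F →* ℤˣ) (a : F) : ℤ := ((χ (sqv F a) : ℤˣ) : ℤ)

noncomputable def q1 (F : Type) [Field F] : FreeRP F →ₗ[RF F] RP' F :=
  Submodule.mkQ _

noncomputable def q2 (F : Type) [Field F] (χ : SqCl F →* ℤˣ) : RP' F →ₗ[RF F] ChiQuot F χ (RP' F) :=
  Submodule.mkQ _

theorem q1_rel (F : Type) [Field F] (w : FreeRP F)
    (h : w ∈ ({gen F 1} ∪ ftRels F ∪ minusRels F ∪ invRels F)) : q1 F w = 0 :=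
  (Submodule.Quotient.mk_eq_zero _).2 (Submodule.subset_span h)

theorem q2_cls (F : Type) [Field F] (χ : SqCl F →* ℤˣ) (a : Fˣ) (m : RP' F) :
    q2 F χ (cls F a • m) = ((χ (sqc F a) : ℤˣ) : ℤ) • q2 F χ m := by
  have h : q2 F χ (cls F a • m - ((χ (sqc F a) : ℤˣ) : ℤ) • m) = 0 :=
    (Submodule.Quotient.mk_eq_zero _).2 (Submodule.subset_span ⟨a, m, rfl⟩)
  rw [map_sub, map_zsmul, sub_eq_zero] at h
  exact h

theorem g_U (F : Type) [Field F] (χ : SqCl F →* ℤˣ) (a : F) (h : a ≠ 0) :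
    g F χ a = q2 F χ (q1 F (gen F (U F a h))) := by
  rw [g, dif_pos h]; rfl

theorem g_unit (F : Type) [Field F] (χ : SqCl F →* ℤˣ) (a : Fˣ) :
    g F χ (a : F) = q2 F χ (q1 F (gen F a)) := by
  rw [g_U F χ _ a.ne_zero]; congr 3; exact Units.ext rfl

theorem s_U (F : Type) [Field F] (χ : SqCl F →* ℤˣ) (a : F) (h : a ≠ 0) :
    s F χ a = ((χ (sqc F (U F a h)) : ℤˣ) : ℤ) := by
  rw [s, sqv, dif_pos h]

theorem s_unit (F : Type) [Field F] (χ : SqCl F →* ℤˣ) (a : Fˣ) :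
    s F χ (a : F) = ((χ (sqc F a) : ℤˣ) : ℤ) := by
  rw [s_U F χ _ a.ne_zero]; congr 3; exact Units.ext rfl

theorem s_mul (F : Type) [Field F] (χ : SqCl F →* ℤˣ) (a b : F) (ha : a ≠ 0) (hb : b ≠ 0) :
    s F χ (a * b) = s F χ a * s F χ b := by
  have := s_unit F χ (U F a ha * U F b hb)
  rw [map_mul, map_mul, Units.val_mul, Units.val_mul] at this
  rw [s_U F χ a ha, s_U F χ b hb]
  exact this

theorem s_cases (F : Type) [Field F] (χ : SqCl F →* ℤˣ) (a : F) :
    s F χ a = 1 ∨ s F χ a = -1 := by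
  rcases Int.units_eq_one_or (χ (sqv F a)) with h | h <;> simp [s, h]

theorem s_one (F : Type) [Field F] (χ : SqCl F →* ℤˣ) : s F χ 1 = 1 := by
  have := s_unit F χ 1
  simpa using this

theorem s_inv (F : Type) [Field F] (χ : SqCl F →* ℤˣ) (a : F) (ha : a ≠ 0) :
    s F χ a⁻¹ = s F χ a := by
  have h := s_mul F χ a a⁻¹ ha (inv_ne_zero ha)
  rw [mul_inv_cancel₀ ha, s_one] at h
  rcases s_cases F χ a with h1 | h1 <;> rw [h1] at h ⊢ <;> omega

theorem g_inv (F : Type) [Field F] (χ : SqCl F →* ℤˣ) (a : F) (ha : a ≠ 0) :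
    g F χ a⁻¹ = - g F χ a := by
  have h := congrArg (q2 F χ) (q1_rel F _ (Or.inr ⟨U F a ha, rfl⟩))
  rw [map_add, map_add, map_zero, ← g_unit, ← g_unit, Units.val_inv_eq_inv_val] at h
  exact eq_neg_of_add_eq_zero_left h

theorem g_neg (F : Type) [Field F] (χ : SqCl F →* ℤˣ) (a : F) (ha : a ≠ 0) :
    s F χ (-1) • g F χ a = g F χ a := by
  have h := congrArg (q2 F χ) (q1_rel F _ (Or.inl (Or.inr ⟨U F a ha, rfl⟩)))
  rw [map_sub, map_sub, map_smul, q2_cls, map_zero, ← g_unit, ← s_unit, sub_eq_zero] at h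
  exact h

theorem ft (F : Type) [Field F] (χ : SqCl F →* ℤˣ) (x y : F) (hx : x ≠ 0) (hy : y ≠ 0)
    (hx1 : x ≠ 1) (hy1 : y ≠ 1) :
    g F χ x - g F χ y + s F χ x • g F χ (y * x⁻¹)
      - s F χ (x⁻¹ - 1) • g F χ ((1 - x⁻¹) / (1 - y⁻¹))
      + s F χ (1 - x) • g F χ ((1 - x) / (1 - y)) = 0 := by
  have h := congrArg (q2 F χ) (q1_rel F _ (Or.inl (Or.inl (Or.inr
    ⟨U F x hx, U F y hy, hx1, hy1, rfl⟩))))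
  simp only [FT, map_sub, map_add, (q1 F).map_smul] at h
  simp only [q2_cls, map_zero, ← g_unit, ← s_unit] at h
  simpa [U] using h

theorem sq (F : Type) [Field F] (χ : SqCl F →* ℤˣ) (C : ChiQuot F χ (RP' F))
    (hC : ∀ a : F, a ≠ 0 → a ≠ 1 → C = g F χ a + g F χ (1 - a))
    (hm : s F χ (-1) = 1) (z : F) (hz : z ≠ 0) (hs : s F χ z = -1) :
    g F χ (z ^ 2) = s F χ (1 - z) • C := by
  have h1 : z ≠ 1 := by rintro rfl; rw [s_one] at hs; omega
  have h2 : z ≠ -1 := by rintro rfl; omega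
  have h2' : 1 + z ≠ 0 := fun h => h2 (by linear_combination h)
  have h1' : 1 - z ≠ 0 := sub_ne_zero.2 h1.symm
  have hzz : z ^ 2 ≠ 1 := fun h => by
    rcases mul_eq_zero.1 (show (1 - z) * (1 + z) = 0 by linear_combination -h) with h | h
    exacts [h1' h, h2' h]
  have hzz' : 1 - z ^ 2 ≠ 0 := sub_ne_zero.2 hzz.symm
  have hzz'' : z ^ 2 - 1 ≠ 0 := sub_ne_zero.2 hzz
  have h := ft F χ z (z ^ 2) hz (pow_ne_zero 2 hz) h1 hzz
  have e1 : z ^ 2 * z⁻¹ = z := by field_simp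
  have e2 : z⁻¹ - 1 = z⁻¹ * (1 - z) := by field_simp
  have e3 : (1 - z⁻¹) / (1 - (z ^ 2)⁻¹) = 1 - (1 + z)⁻¹ := by
    have : 1 - (z ^ 2)⁻¹ ≠ 0 := by
      rw [sub_ne_zero]; intro h; exact hzz (by rw [eq_comm, inv_eq_one] at h; exact h)
    rw [div_eq_iff this]; field_simp; ring
  have e4 : (1 - z) / (1 - z ^ 2) = (1 + z)⁻¹ := by
    rw [div_eq_iff hzz']; field_simp; ring
  rw [e1, e2, e3, e4, s_mul F χ _ _ (inv_ne_zero hz) h1', s_inv F χ z hz, hs] at h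
  rw [hC (1 + z)⁻¹ (inv_ne_zero h2') (by rw [Ne, inv_eq_one]; intro h; exact hz (by linear_combination h))]
  rw [← sub_eq_zero, ← neg_eq_zero, ← h]
  module

theorem main (F : Type) [Field F] (χ : SqCl F →* ℤˣ) (C : ChiQuot F χ (RP' F))
    (hC : ∀ a : F, a ≠ 0 → a ≠ 1 → C = g F χ a + g F χ (1 - a))
    (hm : s F χ (-1) = 1) (x : F) (hx : x ≠ 0) (hs : s F χ x = -1) (hs1 : s F χ (1 - x) = 1) :
    (2 : ℤ) • g F χ x = (2 : ℤ) • C := by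
  have h1 : x ≠ 1 := by rintro rfl; rw [s_one] at hs; omega
  have h1' : 1 - x ≠ 0 := sub_ne_zero.2 h1.symm
  have h := ft F χ x (1 - x) hx h1' h1 (by intro h; exact hx (by linear_combination -h))
  have e2 : x⁻¹ - 1 = x⁻¹ * (1 - x) := by field_simp
  have e3 : (1 - x⁻¹) / (1 - (1 - x)⁻¹) = (1 - x⁻¹) ^ 2 := by
    have e : 1 - (1 - x)⁻¹ = -x / (1 - x) := by field_simp; ring
    rw [e]; field_simp; ring
  have e4 : (1 - x) / (1 - (1 - x)) = (1 - x) * x⁻¹ := by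
    rw [sub_sub_cancel, div_eq_mul_inv]
  have e5 : 1 - x⁻¹ = (-1) * (x⁻¹ * (1 - x)) := by field_simp; ring
  have hsz : s F χ (x⁻¹ * (1 - x)) = -1 := by
    rw [s_mul F χ _ _ (inv_ne_zero hx) h1', s_inv F χ x hx, hs, hs1]; norm_num
  have hn : x⁻¹ * (1 - x) ≠ 0 := mul_ne_zero (inv_ne_zero hx) h1'
  have hz : 1 - x⁻¹ ≠ 0 := by rw [e5]; exact mul_ne_zero (by norm_num) hn
  have hsq := sq F χ C hC hm (1 - x⁻¹) hz (by
    rw [e5, s_mul F χ _ _ (by norm_num) hn, hm, hsz]; norm_num)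
  rw [sub_sub_cancel, s_inv F χ x hx, hs] at hsq
  rw [e3, hsq, e2, hsz, e4, hs, hs1] at h
  have hc := hC x hx h1
  have h3 : g F χ x - g F χ (1 - x) - C = 0 := by rw [← h]; module
  have h4 : g F χ x = g F χ (1 - x) + C := by rw [← sub_eq_zero, ← h3]; abel
  calc (2 : ℤ) • g F χ x = g F χ x + g F χ x := two_zsmul _
    _ = (g F χ x + g F χ (1 - x)) + C := by nth_rw 2 [h4]; abel
    _ = (2 : ℤ) • C := by rw [← hc, two_zsmul]

end S4

/-- Let `F` be a field with at least 4 elements, `χ : G_F → {±1}` a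
character, and `x ∈ F^×` with `χ(x) = -1`.  Then `2·[x]_χ = 2·χ(x-1)·C_F` in `RP′(F)_χ`.
Here `C_F` is the common value of `[x] + [1-x]` over `x ∈ F^× \ {1}`. -/
theorem statement4 (F : Type) [Field F] (hcard : 4 ≤ Cardinal.mk F)
    (c : RP' F)
    (hc : ∀ (x : Fˣ) (hx : (x : F) ≠ 1),
      c = rp F x + rp F (U F (1 - (x : F)) (one_sub_ne hx)))
    (χ : SqCl F →* ℤˣ) (x : Fˣ) (hx : χ (sqc F x) = -1) :
    (2 : ℤ) • mkChi F χ (rp F x) =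
      (2 : ℤ) • (((χ (sqv F ((x : F) - 1)) : ℤˣ) : ℤ) • mkChi F χ c) := by
  have hC : ∀ a : F, a ≠ 0 → a ≠ 1 →
      mkChi F χ c = S4.g F χ a + S4.g F χ (1 - a) := by
    intro a ha ha1
    have h := congrArg (S4.q2 F χ) (hc (U F a ha) ha1)
    rw [map_add] at h
    rw [S4.g_U F χ a ha, S4.g_U F χ (1 - a) (sub_ne_zero.2 ha1.symm)]
    exact h
  have hs : S4.s F χ (x : F) = -1 := by rw [S4.s_unit, hx]; rfl
  have hx0 : (x : F) ≠ 0 := x.ne_zero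
  have h1 : (x : F) ≠ 1 := by intro h; rw [h, S4.s_one] at hs; omega
  have h1' : 1 - (x : F) ≠ 0 := sub_ne_zero.2 h1.symm
  have hg : mkChi F χ (rp F x) = S4.g F χ (x : F) := (S4.g_unit F χ x).symm
  have hneg1 : (-1 : F) ≠ 0 := by norm_num
  change (2 : ℤ) • mkChi F χ (rp F x) = (2 : ℤ) • (S4.s F χ ((x : F) - 1) • mkChi F χ c)
  rw [hg]
  rcases S4.s_cases F χ (-1) with hm | hm
  · have e : S4.s F χ ((x : F) - 1) = S4.s F χ (1 - (x : F)) := by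
      rw [show (x : F) - 1 = (-1) * (1 - (x : F)) by ring, S4.s_mul F χ _ _ hneg1 h1', hm, one_mul]
    rw [e]
    rcases S4.s_cases F χ (1 - (x : F)) with h | h
    · rw [h, one_smul]
      exact S4.main F χ _ hC hm x hx0 hs h
    · have hi := S4.main F χ _ hC hm (x : F)⁻¹ (inv_ne_zero hx0)
        (by rw [S4.s_inv F χ _ hx0, hs]) (by
          have hn : (x : F)⁻¹ * (1 - x) ≠ 0 := mul_ne_zero (inv_ne_zero hx0) h1'
          rw [show 1 - (x : F)⁻¹ = (-1) * ((x : F)⁻¹ * (1 - x)) by field_simp; ring,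
            S4.s_mul F χ _ _ hneg1 hn, S4.s_mul F χ _ _ (inv_ne_zero hx0) h1',
            S4.s_inv F χ _ hx0, hm, hs, h]; norm_num)
      rw [S4.g_inv F χ _ hx0, smul_neg] at hi
      rw [h, neg_smul, one_smul, smul_neg, ← hi, neg_neg]
  · have hz : ∀ a : F, a ≠ 0 → (2 : ℤ) • S4.g F χ a = 0 := by
      intro a ha
      have h := S4.g_neg F χ a ha
      rw [hm, neg_smul, one_smul] at h
      rw [two_zsmul]
      nth_rw 1 [← h]
      exact neg_add_cancel _
    rw [hz _ hx0, smul_comm, hC _ hx0 h1, smul_add, hz _ hx0, hz _ h1', add_zero, smul_zero]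
end

section
/- Let F be a field with at least 4 elements and let v be a valuation on F with residue field k. Then the sequence 0 → K_v → qRP(F) → Ind_F^k qRP(k) → 0, with qRP(F) → Ind_F^k qRP(k) the specialization homomorphism S_v, is a short exact sequence of R_F-modules. -/
open scoped Classical

noncomputable section

variable (F : Type) [Field F]

variable {F}

variable (F)

section PreBloch

variable (k : Type) [Field k]

/-- The plain five-term relation in the free abelian group on `k^×`. -/
def FTZ (x y : kˣ) (hx : (x : k) ≠ 1) (hy : (y : k) ≠ 1) : kˣ →₀ ℤ :=
  Finsupp.single x 1 - Finsupp.single y 1 + Finsupp.single (y * x⁻¹) 1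
    - Finsupp.single (U k ((1 - (x : k)⁻¹) / (1 - (y : k)⁻¹))
        (div_ne_zero (one_sub_inv_ne hx) (one_sub_inv_ne hy))) 1
    + Finsupp.single (U k ((1 - (x : k)) / (1 - (y : k)))
        (div_ne_zero (one_sub_ne hx) (one_sub_ne hy))) 1

/-- The pre-Bloch (scissors congruence) group `P(k)`: generators `[x]`, `x ∈ k^×`,
relations `[1] = 0` and the five-term relations. -/
def PBloch : Type :=
  (kˣ →₀ ℤ) ⧸ Submodule.span ℤ
    ({Finsupp.single (1 : kˣ) (1 : ℤ)} ∪
      {w | ∃ (x y : kˣ) (hx : (x : k) ≠ 1) (hy : (y : k) ≠ 1), w = FTZ k x y hx hy})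

instance : AddCommGroup (PBloch k) := by unfold PBloch; infer_instance

/-- `[x] ∈ P(k)` -/
def pb (x : kˣ) : PBloch k := Submodule.Quotient.mk (Finsupp.single x 1)

end PreBloch

section Conventions

variable (k : Type) [Field k]

/-- The augmentation `R_F → ℤ`. -/
def augRF : RF k →+* ℤ := ((MonoidAlgebra.lift ℤ ℤ (SqCl k)) 1).toRingHom

/-- The augmentation ideal `I_F ⊆ R_F`. -/
def augIdeal : Ideal (RF k) := RingHom.ker (augRF k)

/-- the trivial `R_k`-module structure on an abelian group -/
def trivMod (M : Type) [AddCommGroup M] : Module (RF k) M := Module.compHom _ (augRF k)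

/-- `RP′(F₃)`: the appropriate quotient of the cyclic `R_{F₃}`-module generated by
`[-1]` with the relation `2([-1] + ⟨-1⟩[-1]) = 0`. -/
def RP'3 : Type :=
  RF k ⧸ Submodule.span (RF k)
    {(2 : RF k) * (1 + cls k (-1)), cls k (-1) - 1, 1 + cls k (-1)}

instance : AddCommGroup (RP'3 k) := by unfold RP'3; infer_instance
instance : Module (RF k) (RP'3 k) := by unfold RP'3; infer_instance

/-- `qRP(F₃) = RP(F₃)/⟨ψ₁⟩`, where `RP(F₃)` is the cyclic `R_{F₃}`-module generated
by `[-1]` with the relation `2([-1] + ⟨-1⟩[-1]) = 0`. -/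
def qRP3 : Type :=
  RF k ⧸ Submodule.span (RF k) {(2 : RF k) * (1 + cls k (-1)), 1 + cls k (-1)}

instance : AddCommGroup (qRP3 k) := by unfold qRP3; infer_instance
instance : Module (RF k) (qRP3 k) := by unfold qRP3; infer_instance

/-- `RP′(k)` (bundled), with the conventions for the fields with `2` and `3`
elements:  for `|k| = 2` it is `ℤ/3` with the trivial `R_k`-action, and for
`|k| = 3` it is the module `RP'3 k` above. -/
noncomputable def RP'Kb : ModuleCat (RF k) :=
  if Nat.card k = 2 then (letI := trivMod k (ZMod 3); ModuleCat.of (RF k) (ZMod 3))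
  else if Nat.card k = 3 then ModuleCat.of (RF k) (RP'3 k)
  else ModuleCat.of (RF k) (RP' k)

/-- `RP′(k)`, with the conventions for the fields with `2` and `3` elements. -/
noncomputable abbrev RP'K : Type := (RP'Kb k).carrier

/-- the generators `[u]`, `u ∈ k^×`, of `RP′(k)` (with the small-field conventions;
for `|k| = 2` one has `[1] = 0`, and for `|k| = 3`, `[1] = 0` and `[-1]` is the
distinguished generator) -/
noncomputable def rpK : kˣ → RP'K k := by
  unfold RP'K RP'Kb
  by_cases h2 : Nat.card k = 2
  · rw [if_pos h2]; exact fun _ => 0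
  · rw [if_neg h2]
    by_cases h3 : Nat.card k = 3
    · rw [if_pos h3]
      exact fun u => if (u : k) = 1 then 0 else Submodule.Quotient.mk (1 : RF k)
    · rw [if_neg h3]; exact rp k

/-- `qRP(k)` (bundled), with the conventions for the fields with `2` and `3`
elements. -/
noncomputable def qRPKb : ModuleCat (RF k) :=
  if Nat.card k = 2 then (letI := trivMod k (ZMod 3); ModuleCat.of (RF k) (ZMod 3))
  else if Nat.card k = 3 then ModuleCat.of (RF k) (qRP3 k)
  else ModuleCat.of (RF k) (qRP k)

/-- `qRP(k)`, with the conventions for the fields with `2` and `3` elements. -/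
noncomputable abbrev qRPK : Type := (qRPKb k).carrier

/-- the generators `[u]`, `u ∈ k^×`, of `qRP(k)` (with the small-field conventions) -/
noncomputable def qrpK : kˣ → qRPK k := by
  unfold qRPK qRPKb
  by_cases h2 : Nat.card k = 2
  · rw [if_pos h2]; exact fun _ => 0
  · rw [if_neg h2]
    by_cases h3 : Nat.card k = 3
    · rw [if_pos h3]
      exact fun u => if (u : k) = 1 then 0 else Submodule.Quotient.mk (1 : RF k)
    · rw [if_neg h3]; exact qrp k

/-- The scissors congruence group `P(k)`, with the conventions for the fields with
`2` and `3` elements (`P(F₂) = ℤ/3` and `P(F₃) = ℤ/4`, generated by `[-1]`). -/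
def PBK : Type :=
  if Nat.card k = 2 then ZMod 3 else if Nat.card k = 3 then ZMod 4 else PBloch k

noncomputable instance : AddCommGroup (PBK k) := by
  unfold PBK; split
  · infer_instance
  · split <;> infer_instance

/-- the generators `[u]`, `u ∈ k^×`, of `P(k)` (with the small-field conventions) -/
noncomputable def pbK' : kˣ → PBK k := by
  unfold PBK
  by_cases h2 : Nat.card k = 2
  · rw [if_pos h2]; exact fun _ => 0
  · rw [if_neg h2]
    by_cases h3 : Nat.card k = 3
    · rw [if_pos h3]
      exact fun u => if (u : k) = 1 then 0 else (1 : ZMod 4)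
    · rw [if_neg h3]; exact pb k

end Conventions

section ValuedField

variable (F : Type) [Field F] {Γ₀ : Type} [LinearOrderedCommGroupWithZero Γ₀]
variable (v : Valuation F Γ₀)

/-- The residue field `k(v)` of the valuation ring of `v`. -/
def Resk : Type := IsLocalRing.ResidueField ↥v.valuationSubring

instance : Field (Resk F v) := by unfold Resk; infer_instance

/-- the unit group `U_v` of the valuation ring -/
def Uv : Type := (↥v.valuationSubring)ˣ

instance : CommGroup (Uv F v) := by unfold Uv; infer_instance

/-- `ℤ[U_v]` -/
def ZU : Type := MonoidAlgebra ℤ (Uv F v)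

instance : CommRing (ZU F v) := by unfold ZU; infer_instance

/-- `U_v →* F^×` -/
def uvToUnits : Uv F v →* Fˣ := Units.map (v.valuationSubring.subtype).toMonoidHom

/-- `U_v →* k^×` (reduction modulo the maximal ideal) -/
def uvToResUnits : Uv F v →* (Resk F v)ˣ :=
  Units.map (IsLocalRing.residue ↥v.valuationSubring).toMonoidHom

/-- `ℤ[U_v] → R_F` -/
def zuF : ZU F v →+* RF F :=
  MonoidAlgebra.mapDomainRingHom ℤ ((sqc F).comp (uvToUnits F v))

/-- `ℤ[U_v] → R_{k(v)}` -/
def zuK : ZU F v →+* RF (Resk F v) :=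
  MonoidAlgebra.mapDomainRingHom ℤ ((sqc (Resk F v)).comp (uvToResUnits F v))

/-- `Ind_F^k M = R_F ⊗_{ℤ[U_v]} M` for an `R_k`-module `M`. -/
def IndMod (M : Type) [AddCommGroup M] [Module (RF (Resk F v)) M] : Type :=
  @TensorProduct (ZU F v) _ (RF F) M _ _
    (Module.compHom _ (zuF F v)) (Module.compHom _ (zuK F v))

noncomputable instance (M : Type) [AddCommGroup M] [Module (RF (Resk F v)) M] :
    AddCommGroup (IndMod F v M) := by
  unfold IndMod
  letI : Module (ZU F v) (RF F) := Module.compHom _ (zuF F v)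
  letI : Module (ZU F v) M := Module.compHom _ (zuK F v)
  infer_instance

noncomputable instance (M : Type) [AddCommGroup M] [Module (RF (Resk F v)) M] :
    Module (RF F) (IndMod F v M) := by
  unfold IndMod
  letI : Module (ZU F v) (RF F) := Module.compHom _ (zuF F v)
  letI : Module (ZU F v) M := Module.compHom _ (zuK F v)
  letI : SMulCommClass (ZU F v) (RF F) (RF F) :=
    ⟨fun r s t => by
      show zuF F v r * (s * t) = s * (zuF F v r * t)
      ring⟩
  exact TensorProduct.leftModule

/-- the element `r ⊗ m` of `Ind_F^k M` -/
noncomputable def indE (M : Type) [AddCommGroup M] [Module (RF (Resk F v)) M]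
    (r : RF F) (m : M) : IndMod F v M :=
  letI : Module (ZU F v) (RF F) := Module.compHom _ (zuF F v)
  letI : Module (ZU F v) M := Module.compHom _ (zuK F v)
  r ⊗ₜ[ZU F v] m

/-- a unit of `F` of valuation `1` gives a unit of the valuation ring -/
def unitOfVal (x : Fˣ) (hx : v (x : F) = 1) : Uv F v :=
  { val := ⟨(x : F), le_of_eq hx⟩
    inv := ⟨((x : F)⁻¹),
      by
        rw [Valuation.mem_valuationSubring_iff, map_inv₀, hx, inv_one]⟩
    val_inv := by
      apply Subtype.ext
      simp [mul_inv_cancel₀ (Units.ne_zero x)]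
    inv_val := by
      apply Subtype.ext
      simp [inv_mul_cancel₀ (Units.ne_zero x)] }

/-- the image in `k(v)^×` of a unit of `F` of valuation `1` -/
def resUnit (x : Fˣ) (hx : v (x : F) = 1) : (Resk F v)ˣ :=
  uvToResUnits F v (unitOfVal F v x hx)

end ValuedField

section DiscreteValuationChar

variable (F : Type) [Field F]

/-- The character `χ_v : G_F → {±1}`, `⟨a⟩ ↦ (-1)^{v(a)}`, associated to a
homomorphism `v : F^× → ℤ`. -/
def chiV (v : Fˣ → ℤ) (hv : ∀ x y : Fˣ, v (x * y) = v x + v y) : SqCl F →* ℤˣ :=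
  QuotientGroup.lift _
    { toFun := fun x => (-1 : ℤˣ) ^ (v x)
      map_one' := by
        have h1 : v 1 = v 1 + v 1 := by simpa using (hv 1 1).symm
        have h0 : v 1 = 0 := by omega
        simp [h0]
      map_mul' := fun x y => by simp only [hv, zpow_add] }
    (by
      rintro w ⟨y, rfl⟩
      show (-1 : ℤˣ) ^ (v (y ^ 2)) = 1
      have : v (y ^ 2) = v y + v y := by rw [pow_two]; exact hv y y
      rw [this, zpow_add]
      exact Int.units_mul_self _)

/-- The set `U_n = 1 + M_v^n ⊆ F^×` for a discrete valuation `v`. -/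
def UnSet (v : Fˣ → ℤ) (n : ℕ) : Set Fˣ :=
  {u : Fˣ | (u : F) = 1 ∨ ∃ h : (u : F) - 1 ≠ 0, (n : ℤ) ≤ v (U F ((u : F) - 1) h)}

end DiscreteValuationChar

section DiscreteValuationZ

variable (F : Type) [Field F]

/-- the additive value `v(x) ∈ ℤ` of a unit, for a (multiplicatively written)
valuation `v : F → ℤₘ₀` -/
def vzk (v : Valuation F (WithZero (Multiplicative ℤ))) (x : Fˣ) : ℤ :=
  - Multiplicative.toAdd (WithZero.unzero ((Valuation.ne_zero_iff v).mpr (Units.ne_zero x)))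

theorem vzk_mul (v : Valuation F (WithZero (Multiplicative ℤ))) (x y : Fˣ) :
    vzk F v (x * y) = vzk F v x + vzk F v y := by
  have h1 : v ((↑(x * y) : F)) ≠ 0 := (Valuation.ne_zero_iff v).mpr (Units.ne_zero (x * y))
  have h2 : v ((x : F)) ≠ 0 := (Valuation.ne_zero_iff v).mpr (Units.ne_zero x)
  have h3 : v ((y : F)) ≠ 0 := (Valuation.ne_zero_iff v).mpr (Units.ne_zero y)
  have key : WithZero.unzero h1 = WithZero.unzero h2 * WithZero.unzero h3 := by
    rw [← WithZero.coe_inj, WithZero.coe_mul, WithZero.coe_unzero, WithZero.coe_unzero,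
      WithZero.coe_unzero, Units.val_mul, map_mul]
  unfold vzk
  show -Multiplicative.toAdd (WithZero.unzero h1) =
      -Multiplicative.toAdd (WithZero.unzero h2) + -Multiplicative.toAdd (WithZero.unzero h3)
  rw [key, toAdd_mul]
  ring

/-- the character `χ_v` of a (surjective) discrete valuation `v : F → ℤₘ₀` -/
def chiVal (v : Valuation F (WithZero (Multiplicative ℤ))) : SqCl F →* ℤˣ :=
  chiV F (vzk F v) (vzk_mul F v)

/-- The subset `U_n = 1 + M_v^n` of `F^×`, for a surjective discrete valuation
`v : F → ℤₘ₀`:  the units `u` with `v(u - 1) ≥ n` (additively). -/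
def UnV (v : Valuation F (WithZero (Multiplicative ℤ))) (n : ℕ) : Set Fˣ :=
  {u : Fˣ | ∀ h : (u : F) - 1 ≠ 0, (n : ℤ) ≤ vzk F v (U F ((u : F) - 1) h)}

end DiscreteValuationZ

section KvMathlib

variable (F : Type) [Field F] {Γ₀ : Type} [LinearOrderedCommGroupWithZero Γ₀]

/-- `1 + M_v ⊆ F^×` -/
def U1V (v : Valuation F Γ₀) : Set Fˣ := {u : Fˣ | v ((u : F) - 1) < 1}

/-- `K_v ⊆ qRP(F)`: the `R_F`-submodule generated by the `[u]` with `u ∈ 1 + M_v`. -/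
def KvV (v : Valuation F Γ₀) : Submodule (RF F) (qRP F) :=
  Submodule.span (RF F) (qrp F '' U1V F v)

end KvMathlib
end

noncomputable section
namespace S5

def sg (F : Type) [Field F] (a : F) : RF F := if h : a = 0 then 0 else cls F (U F a h)

section
variable {F : Type} [Field F]

theorem sg_of {a : F} (h : a ≠ 0) : sg F a = cls F (U F a h) := by
  unfold sg; rw [dif_neg h]

theorem sg_unit (u : Fˣ) : sg F (u : F) = cls F u := by
  rw [sg_of u.ne_zero]; congr 1; ext; rfl

theorem cls_mul (a b : Fˣ) : cls F (a * b) = cls F a * cls F b := by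
  unfold cls; rw [map_mul, map_mul]

theorem sg_mul (a b : F) : sg F (a * b) = sg F a * sg F b := by
  by_cases ha : a = 0
  · simp [sg, ha]
  by_cases hb : b = 0
  · simp [sg, hb]
  rw [sg_of ha, sg_of hb, sg_of (mul_ne_zero ha hb), ← cls_mul]
  congr 1; ext; rfl

theorem sg_one : sg F 1 = 1 := by
  have := sg_unit (1 : Fˣ)
  rw [Units.val_one] at this
  rw [this]; unfold cls; rw [map_one, map_one]

theorem sqc_sq (a : Fˣ) : sqc F (a ^ 2) = 1 :=
  (QuotientGroup.eq_one_iff _).2 ⟨a, rfl⟩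

theorem sg_sq {a : F} (h : a ≠ 0) : sg F a * sg F a = 1 := by
  rw [← sg_mul, ← pow_two]
  have := sg_unit ((U F a h) ^ 2)
  have e : (((U F a h) ^ 2 : Fˣ) : F) = a ^ 2 := by rw [Units.val_pow_eq_pow_val]; rfl
  rw [e] at this
  rw [this]; unfold cls; rw [sqc_sq, map_one]

theorem sg_inv (a : F) : sg F a⁻¹ = sg F a := by
  by_cases ha : a = 0
  · simp [ha]
  have h1 : sg F a * sg F a⁻¹ = 1 := by rw [← sg_mul, mul_inv_cancel₀ ha, sg_one]
  calc sg F a⁻¹ = (sg F a * sg F a) * sg F a⁻¹ := by rw [sg_sq ha, one_mul]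
    _ = sg F a := by rw [mul_assoc, h1, mul_one]

theorem sg_m1 : sg F (-1) * sg F (-1) = 1 := sg_sq (by simp)

structure Dat (F : Type) [Field F] (M : Type) [AddCommGroup M] [Module (RF F) M] (p : F → M) :
    Prop where
  five : ∀ x y : F, x ≠ 0 → x ≠ 1 → y ≠ 0 → y ≠ 1 →
    p x - p y + sg F x • p (y / x) - sg F (x⁻¹ - 1) • p ((1 - x⁻¹) / (1 - y⁻¹))
      + sg F (1 - x) • p ((1 - x) / (1 - y)) = 0
  psi : ∀ x : F, x ≠ 0 → p x + sg F (-1) • p x⁻¹ = 0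

variable {M : Type} [AddCommGroup M] [Module (RF F) M] {p : F → M}

theorem sg_inv_sub {x : F} (h0 : x ≠ 0) : sg F (x⁻¹ - 1) = sg F x * sg F (1 - x) := by
  have : x⁻¹ - 1 = x⁻¹ * (1 - x) := by field_simp
  rw [this, sg_mul, sg_inv]

theorem Dat.const (D : Dat F M p) (x y : F) (hx0 : x ≠ 0) (hx1 : x ≠ 1) (hy0 : y ≠ 0)
    (hy1 : y ≠ 1) : p x + sg F (-1) • p (1 - x) = p y + sg F (-1) • p (1 - y) := by
  have hx1' : 1 - x ≠ 0 := sub_ne_zero.2 (Ne.symm hx1)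
  have hy1' : 1 - y ≠ 0 := sub_ne_zero.2 (Ne.symm hy1)
  have A := D.five x y hx0 hx1 hy0 hy1
  have B := D.five (1 - x) (1 - y) hx1' (by simpa using hx0) hy1' (by simpa using hy0)
  rw [sg_inv_sub hx0] at A
  rw [sg_inv_sub hx1'] at B
  have e1 : 1 - (1 - x) = x := by ring
  have e2 : 1 - (1 - y) = y := by ring
  rw [e1, e2] at B
  have hx1'' : x - 1 ≠ 0 := sub_ne_zero.2 hx1
  have hy1'' : y - 1 ≠ 0 := sub_ne_zero.2 hy1
  have e3 : (1 - (1 - x)⁻¹) / (1 - (1 - y)⁻¹) = ((1 - x⁻¹) / (1 - y⁻¹))⁻¹ := by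
    have h1 : 1 - (1 - x)⁻¹ = -x / (1 - x) := by field_simp; ring
    have h2 : 1 - (1 - y)⁻¹ = -y / (1 - y) := by field_simp; ring
    have h3 : 1 - x⁻¹ = -(1 - x) / x := by field_simp; ring
    have h4 : 1 - y⁻¹ = -(1 - y) / y := by field_simp; ring
    rw [h1, h2, h3, h4]; field_simp
  have hz : (1 - x⁻¹) / (1 - y⁻¹) ≠ 0 := by
    refine div_ne_zero (sub_ne_zero.2 fun h => hx1 ?_) (sub_ne_zero.2 fun h => hy1 ?_)
    · exact (inv_eq_one.1 h.symm)
    · exact (inv_eq_one.1 h.symm)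
  have P1 := D.psi ((1 - x⁻¹) / (1 - y⁻¹)) hz
  have P2 := D.psi (y / x) (div_ne_zero hy0 hx0)
  have P3 := D.psi ((1 - x) / (1 - y)) (div_ne_zero hx1' hy1')
  rw [inv_div] at P2 P3
  rw [e3] at B
  have hm : (sg F (-1)) * sg F (-1) = 1 := sg_m1
  generalize p ((1 - x⁻¹) / (1 - y⁻¹)) = a at *
  generalize p ((1 - x⁻¹) / (1 - y⁻¹))⁻¹ = b at *
  rw [← sub_eq_zero]
  have := congrArg (fun m => sg F (-1) • m) B
  linear_combination (norm := module) A + sg F (-1) • B - sg F x • P2 - sg F (1 - x) • P3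
    + (sg F x * sg F (1 - x)) • P1

theorem Dat.exC (D : Dat F M p) (x0 : F) (h0 : x0 ≠ 0) (h1 : x0 ≠ 1) :
    ∃ C : M, (∀ x : F, x ≠ 0 → x ≠ 1 → C = p x + sg F (-1) • p (1 - x)) ∧
      sg F (-1) • C = C ∧ C + C + C = 0 := by
  refine ⟨p x0 + sg F (-1) • p (1 - x0), fun x hx0 hx1 => D.const _ _ h0 h1 hx0 hx1, ?_, ?_⟩
  · have h1' : 1 - x0 ≠ 0 := sub_ne_zero.2 (Ne.symm h1)
    rw [D.const x0 (1 - x0) h0 h1 h1' (by simpa using h0)]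
    have e1 : 1 - (1 - x0) = x0 := by ring
    rw [e1, smul_add, smul_smul, sg_m1, one_smul, add_comm]
    have := D.const (1 - x0) x0 h1' (by simpa using h0) h0 h1
    rw [e1] at this
    exact this.symm
  · have key : ∀ x : F, x ≠ 0 → x ≠ 1 →
        p x0 + sg F (-1) • p (1 - x0) = p x - p (1 - x)⁻¹ := by
      intro x hx0 hx1
      have hx1' : 1 - x ≠ 0 := sub_ne_zero.2 (Ne.symm hx1)
      rw [D.const x0 x h0 h1 hx0 hx1]
      have := D.psi (1 - x)⁻¹ (inv_ne_zero hx1')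
      rw [inv_inv] at this
      linear_combination (norm := module) this
    have h1' : 1 - x0 ≠ 0 := sub_ne_zero.2 (Ne.symm h1)
    have k1 := key x0 h0 h1
    have k2 := key (1 - x0)⁻¹ (inv_ne_zero h1') (by
      intro h; rw [inv_eq_one] at h; exact h0 (by linear_combination -h))
    have e2 : (1 - (1 - x0)⁻¹)⁻¹ = (x0 - 1) / x0 := by
      have : 1 - (1 - x0)⁻¹ = (-x0) / (1 - x0) := by field_simp; ring
      rw [this, inv_div]; field_simp; ring
    have k3 := key ((x0 - 1) / x0) (div_ne_zero (sub_ne_zero.2 h1) h0) (by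
      intro h; rw [div_eq_one_iff_eq h0] at h; simp at h)
    have e3 : (1 - (x0 - 1) / x0)⁻¹ = x0 := by
      have : 1 - (x0 - 1) / x0 = 1 / x0 := by field_simp; ring
      rw [this]; simp
    rw [e2] at k2; rw [e3] at k3
    linear_combination (norm := module) k1 + k2 + k3

theorem Dat.one (D : Dat F M p) (x0 y0 : F) (h0 : x0 ≠ 0) (h1 : x0 ≠ 1) (h0' : y0 ≠ 0)
    (h1' : y0 ≠ 1) (h : x0 * y0 ≠ 1) : p 1 = 0 := by
  have A : ∀ x : F, x ≠ 0 → x ≠ 1 →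
      sg F x • p 1 - (sg F x * sg F (1 - x)) • p 1 + sg F (1 - x) • p 1 = 0 := by
    intro x hx0 hx1
    have := D.five x x hx0 hx1 hx0 hx1
    have hz : 1 - x⁻¹ ≠ 0 := sub_ne_zero.2 fun h => hx1 (inv_eq_one.1 h.symm)
    rw [div_self hx0, div_self hz, div_self (sub_ne_zero.2 (Ne.symm hx1)), sg_inv_sub hx0] at this
    rw [← this]; abel
  have B : ∀ x : F, x ≠ 0 → x ≠ 1 → sg F x • p 1 = - p 1 := by
    intro x hx0 hx1
    have a := A x hx0 hx1
    have hs : sg F x * sg F x = 1 := sg_sq hx0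
    have b := congrArg (fun m => sg F x • m) a
    simp only [smul_add, smul_sub, smul_smul, ← mul_assoc, hs, one_smul, one_mul, smul_zero] at b
    linear_combination (norm := module) a + b
  have hxx := B x0 h0 h1
  have hyy := B y0 h0' h1'
  have hxy := B _ (mul_ne_zero h0 h0') h
  have h1x := B (1 - x0) (sub_ne_zero.2 (Ne.symm h1)) (by simpa using h0)
  have a := A x0 h0 h1
  rw [mul_smul, h1x, smul_neg, hxx] at a
  rw [sg_mul, mul_smul, hyy, smul_neg, hxx] at hxy
  linear_combination (norm := module) - a - hxy

end
end S5
end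

noncomputable section
namespace S5

def mkq (F : Type) [Field F] : FreeRP F →ₗ[RF F] qRP F :=
  (Submodule.span (RF F) (ftRels F ∪ psiRels F)).mkQ

section
variable {F : Type} [Field F]

theorem mkq_gen (x : Fˣ) : mkq F (gen F x) = qrp F x := rfl

theorem mkq_rel {w : FreeRP F} (h : w ∈ ftRels F ∪ psiRels F) : mkq F w = 0 :=
  (Submodule.Quotient.mk_eq_zero _).2 (Submodule.subset_span h)

theorem mkq_surj : Function.Surjective (mkq F) := Submodule.mkQ_surjective _

def pF (F : Type) [Field F] (a : F) : qRP F := if h : a = 0 then 0 else qrp F (U F a h)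

theorem pF_of {a : F} (h : a ≠ 0) : pF F a = qrp F (U F a h) := by
  unfold pF; rw [dif_neg h]

theorem pF_unit (u : Fˣ) : pF F (u : F) = qrp F u := by
  rw [pF_of u.ne_zero]; congr 1; ext; rfl

theorem datF : Dat F (qRP F) (pF F) where
  five x y hx0 hx1 hy0 hy1 := by
    have := mkq_rel (F := F) (w := FT F (U F x hx0) (U F y hy0) hx1 hy1)
      (Or.inl ⟨_, _, _, _, rfl⟩)
    unfold FT at this
    simp only [map_add, map_sub, map_smul, mkq_gen, ← pF_unit, ← sg_unit] at this
    simpa [U, div_eq_mul_inv] using this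
  psi x hx := by
    have := mkq_rel (F := F) (w := gen F (U F x hx) + cls F (-1) • gen F (U F x hx)⁻¹)
      (Or.inr ⟨_, rfl⟩)
    simp only [map_add, map_sub, map_smul, mkq_gen, ← pF_unit, ← sg_unit] at this
    simpa [U, div_eq_mul_inv] using this

theorem qRP_span : Submodule.span (RF F) (Set.range (qrp F)) = ⊤ := by
  rw [eq_top_iff]
  rintro z -
  obtain ⟨w, rfl⟩ := mkq_surj z
  induction w using Finsupp.induction_linear with
  | zero => simp
  | add f g hf hg => rw [map_add]; exact Submodule.add_mem _ hf hg
  | single a r =>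
    have : (Finsupp.single a r : FreeRP F) = r • gen F a := by simp [gen]
    rw [this, map_smul]
    exact Submodule.smul_mem _ _ (Submodule.subset_span ⟨a, rfl⟩)

variable {M : Type} [AddCommGroup M] [Module (RF F) M] {p : F → M}

theorem Dat.lift (D : Dat F M p) : ∃ T : qRP F →ₗ[RF F] M, ∀ u : Fˣ, T (qrp F u) = p u := by
  let L : FreeRP F →ₗ[RF F] M := Finsupp.linearCombination (RF F) (fun u : Fˣ => p u)
  have hL : ∀ u, L (gen F u) = p u := by
    intro u; simp [L, gen]
  refine ⟨(Submodule.span (RF F) (ftRels F ∪ psiRels F)).liftQ L ?_, fun u => hL u⟩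
  rw [Submodule.span_le]
  rintro w (⟨x, y, hx, hy, rfl⟩ | ⟨x, rfl⟩)
  · show L _ = 0
    have := D.five x y x.ne_zero hx y.ne_zero hy
    unfold FT
    simp only [map_add, map_sub, map_smul, hL, ← sg_unit]
    simpa [U, div_eq_mul_inv] using this
  · show L _ = 0
    have := D.psi x x.ne_zero
    simp only [map_add, map_sub, map_smul, hL, ← sg_unit]
    simpa using this
end

section
variable {k : Type} [Field k]

theorem big_case (h2 : Nat.card k ≠ 2) (h3 : Nat.card k ≠ 3) :
    ∃ e : qRPK k ≃ₗ[RF k] qRP k, ∀ u, e (qrpK k u) = qrp k u := by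
  have hb : qRPKb k = ModuleCat.of (RF k) (qRP k) := by
    unfold qRPKb; rw [if_neg h2, if_neg h3]
  have hq : HEq (qrpK k) (qrp k) := by
    unfold qrpK
    simp [h2, h3]
    exact cast_heq _ _
  have gen : ∀ (N : ModuleCat (RF k)) (f : kˣ → N.carrier), N = ModuleCat.of (RF k) (qRP k) →
      HEq f (qrp k) → ∃ e : N.carrier ≃ₗ[RF k] qRP k, ∀ u, e (f u) = qrp k u := by
    rintro N f rfl hf
    obtain rfl := eq_of_heq hf
    exact ⟨LinearEquiv.refl _ _, fun u => rfl⟩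
  exact gen _ _ hb hq

def q3 (k : Type) [Field k] : RF k →ₗ[RF k] qRP3 k :=
  (Submodule.span (RF k) {(2 : RF k) * (1 + cls k (-1)), 1 + cls k (-1)}).mkQ

theorem q3_surj : Function.Surjective (q3 k) := Submodule.mkQ_surjective _

theorem three_case (h3 : Nat.card k = 3) :
    ∃ e : qRPK k ≃ₗ[RF k] qRP3 k, (∀ u : kˣ, (u : k) = 1 → e (qrpK k u) = 0) ∧
      ∀ u : kˣ, (u : k) ≠ 1 → e (qrpK k u) = q3 k 1 := by
  have h2 : Nat.card k ≠ 2 := by omega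
  have hb : qRPKb k = ModuleCat.of (RF k) (qRP3 k) := by
    unfold qRPKb; rw [if_neg h2, if_pos h3]
  have hq : HEq (qrpK k) (fun u : kˣ => if (u : k) = 1 then (0 : qRP3 k) else
      Submodule.Quotient.mk (1 : RF k)) := by
    unfold qrpK
    simp [h3]
    exact cast_heq _ _
  have gen : ∀ (N : ModuleCat (RF k)) (f : kˣ → N.carrier) (g : kˣ → qRP3 k),
      N = ModuleCat.of (RF k) (qRP3 k) →
      HEq f g → ∃ e : N.carrier ≃ₗ[RF k] qRP3 k, ∀ u, e (f u) = g u := by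
    rintro N f g rfl hf
    obtain rfl := eq_of_heq hf
    exact ⟨LinearEquiv.refl _ _, fun u => rfl⟩
  obtain ⟨e, he⟩ := gen _ _ _ hb hq
  refine ⟨e, fun u hu => (he u).trans (if_pos hu), fun u hu => (he u).trans (if_neg hu)⟩

theorem two_case (h2 : Nat.card k = 2) :
    (∃ e : qRPK k ≃+ ZMod 3, ∀ (r : RF k) m, e (r • m) = augRF k r • e m) ∧
      ∀ u : kˣ, qrpK k u = 0 := by
  have hb : qRPKb k = (letI := trivMod k (ZMod 3); ModuleCat.of (RF k) (ZMod 3)) := by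
    unfold qRPKb; rw [if_pos h2]
  have hq : HEq (qrpK k) (fun u : kˣ => (0 : ZMod 3)) := by
    unfold qrpK
    simp [h2]
    exact cast_heq _ _
  have gen : ∀ (N : ModuleCat (RF k)) (f : kˣ → N.carrier),
      N = (letI := trivMod k (ZMod 3); ModuleCat.of (RF k) (ZMod 3)) →
      HEq f (fun u : kˣ => (0 : ZMod 3)) →
      (∃ e : N.carrier ≃+ ZMod 3, ∀ (r : RF k) m, e (r • m) = augRF k r • e m) ∧
      ∀ u, f u = 0 := by
    rintro N f rfl hf
    obtain rfl := eq_of_heq hf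
    exact ⟨⟨AddEquiv.refl _, fun r m => rfl⟩, fun u => rfl⟩
  exact gen _ _ hb hq
end
end S5
end

noncomputable section
namespace S5
section
variable {k : Type} [Field k]

theorem card_of_forall (s : Finset k) (h : ∀ a, a ∈ s) : Nat.card k = s.card := by
  have : (s : Set k) = Set.univ := by ext a; simp [h a]
  rw [← Set.ncard_univ, ← this, Set.ncard_coe_finset]

theorem ex_one (h2 : Nat.card k ≠ 2) : ∃ a : k, a ≠ 0 ∧ a ≠ 1 := by
  by_contra! hc
  apply h2
  rw [card_of_forall {0, 1}]
  · rw [Finset.card_pair zero_ne_one]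
  · intro a
    by_cases h : a = 0
    · simp [h]
    · simp [hc a h]

theorem ex_two (h2 : Nat.card k ≠ 2) (h3 : Nat.card k ≠ 3) :
    ∃ a b : k, a ≠ 0 ∧ a ≠ 1 ∧ b ≠ 0 ∧ b ≠ 1 ∧ a * b ≠ 1 := by
  obtain ⟨a, ha0, ha1⟩ := ex_one h2
  refine ⟨a, ?_⟩
  by_contra! hc
  apply h3
  rw [card_of_forall {0, 1, a⁻¹}]
  · rw [Finset.card_eq_three]
    exact ⟨0, 1, a⁻¹, zero_ne_one, (inv_ne_zero ha0).symm,
      fun h => ha1 (inv_eq_one.1 h.symm), rfl⟩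
  · intro b
    by_cases h : b = 0
    · simp [h]
    · by_cases h' : b = 1
      · simp [h']
      · have := hc b ha0 ha1 h h'
        simp [eq_inv_of_mul_eq_one_right this]

theorem unit_pow (n : ℕ) (hn : Nat.card k = n + 2) (u : kˣ) : u ^ (n + 1) = 1 := by
  have : Finite k := Nat.finite_of_card_ne_zero (by omega)
  have h := Nat.card_units k
  rw [hn] at h
  have := pow_card_eq_one' (x := u)
  rwa [h] at this

theorem two_unit (h : Nat.card k = 2) (u : kˣ) : u = 1 := by
  simpa using unit_pow 0 h u

theorem three_unit (h : Nat.card k = 3) (u : kˣ) (hu : (u : k) ≠ 1) : (u : k) = -1 := by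
  have := congrArg (Units.val) (unit_pow 1 h u)
  simp only [Units.val_pow_eq_pow_val, Units.val_one] at this
  have h' : ((u : k) - 1) * (u + 1) = 0 := by linear_combination this
  rcases mul_eq_zero.1 h' with h | h
  · exact absurd (sub_eq_zero.1 h) hu
  · exact eq_neg_of_add_eq_zero_left h

theorem two_aug (h : Nat.card k = 2) (r : RF k) : r = ((augRF k r : ℤ) : RF k) := by
  have hg : ∀ g : SqCl k, g = 1 := by
    intro g
    obtain ⟨u, rfl⟩ := QuotientGroup.mk_surjective g
    rw [two_unit h u]; rfl
  induction r using MonoidAlgebra.induction_on with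
  | of g => rw [hg g, map_one, map_one, Int.cast_one]
  | add f g hf hg => rw [map_add, Int.cast_add, ← hf, ← hg]
  | smul n f hf =>
    rw [zsmul_eq_mul, map_mul, Int.cast_mul, ← hf]; simp

section
variable {N : Type} [AddCommGroup N] [Module (RF k) N] {φ : k → N}

theorem lift_two (h2 : Nat.card k = 2) (h1 : φ 1 = 0) (C : N) (h3 : C + C + C = 0)
    (ck : qRPK k) (hck2 : ck ≠ 0) :
    ∃ T : qRPK k →ₗ[RF k] N, (∀ u : kˣ, T (qrpK k u) = φ u) ∧ T ck = C := by
  obtain ⟨⟨e, he⟩, hq⟩ := two_case (k := k) h2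
  have key : ∀ D : N, D + D + D = 0 → ∃ T : qRPK k →ₗ[RF k] N, ∀ m, e m = 1 → T m = D := by
    intro D hD
    let f : ZMod 3 →+ N := ZMod.lift 3 ⟨zmultiplesHom N D, by
      rw [zmultiplesHom_apply]
      rw [← hD]; simp only [Nat.cast_ofNat]; module⟩
    refine ⟨{ toFun := fun m => f (e m), map_add' := by simp, map_smul' := ?_ }, ?_⟩
    · intro r m
      rw [he, map_zsmul, RingHom.id_apply]
      conv_rhs => rw [two_aug h2 r]
      rw [Int.cast_smul_eq_zsmul]
    · intro m hm
      show f (e m) = D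
      rw [hm]
      have : (1 : ZMod 3) = ((1 : ℤ) : ZMod 3) := by simp
      rw [this]
      simp only [f, ZMod.lift_coe]
      simp
  have hφ : ∀ u : kˣ, φ u = 0 := by
    intro u; rw [two_unit h2 u]; exact h1
  have hz : ∀ z : ZMod 3, z ≠ 0 → z = 1 ∨ -z = 1 := by decide
  have hne : e ck ≠ 0 := by simpa using hck2
  rcases hz _ hne with h | h
  · obtain ⟨T, hT⟩ := key C h3
    exact ⟨T, fun u => by rw [hq, map_zero, hφ], hT _ h⟩
  · obtain ⟨T, hT⟩ := key C h3
    refine ⟨-T, fun u => by rw [hq, map_zero, hφ], ?_⟩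
    have := hT (-ck) (by rw [map_neg, h])
    rw [LinearMap.neg_apply, ← map_neg, this]

theorem qlift (D : Dat k N φ) (h1 : φ 1 = 0) (C : N) (h3 : C + C + C = 0)
    (hC : ∀ a : k, a ≠ 0 → a ≠ 1 → C = φ a + sg k (-1) • φ (1 - a))
    (ck : qRPK k)
    (hck : ∀ (u : kˣ) (hu : (u : k) ≠ 1),
      ck = qrpK _ u + cls k (-1) • qrpK _ (U k (1 - (u : k)) (one_sub_ne hu)))
    (hck2 : Nat.card k = 2 → ck ≠ 0) :
    ∃ T : qRPK k →ₗ[RF k] N, (∀ u : kˣ, T (qrpK k u) = φ u) ∧ T ck = C := by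
  by_cases c2 : Nat.card k = 2
  · exact lift_two c2 h1 C h3 ck (hck2 c2)
  suffices h : ∃ T : qRPK k →ₗ[RF k] N, (∀ u : kˣ, T (qrpK k u) = φ u) by
    obtain ⟨T, hT⟩ := h
    refine ⟨T, hT, ?_⟩
    obtain ⟨a, ha0, ha1⟩ := ex_one c2
    rw [hck (U k a ha0) ha1, map_add, map_smul, hT, hT, hC a ha0 ha1, ← sg_unit]
    simp [U]
  by_cases c3 : Nat.card k = 3
  · obtain ⟨e, he1, he⟩ := three_case c3
    have hp := D.psi (-1) (by simp)
    rw [inv_neg, inv_one] at hp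
    have h0 : (1 + cls k (-1)) • φ (-1) = 0 := by
      rw [add_smul, one_smul, ← hp, ← sg_unit]; simp
    let L : qRP3 k →ₗ[RF k] N := Submodule.liftQ _ (LinearMap.toSpanSingleton (RF k) N (φ (-1)))
      (by
        rw [Submodule.span_le]
        rintro w (h | h)
        · show w • φ (-1) = 0
          rw [h, mul_smul, h0, smul_zero]
        · show w • φ (-1) = 0
          rw [Set.mem_singleton_iff.1 h]
          exact h0)
    have hL : L (q3 k 1) = φ (-1) := by
      show (1 : RF k) • φ (-1) = _
      rw [one_smul]
    refine ⟨L.comp e.toLinearMap, fun u => ?_⟩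
    show L (e _) = _
    by_cases hu : (u : k) = 1
    · rw [he1 u hu, map_zero, hu, h1]
    · rw [he u hu, hL, three_unit c3 u hu]
  · obtain ⟨e, he⟩ := big_case c2 c3
    obtain ⟨T, hT⟩ := D.lift
    exact ⟨T.comp e.toLinearMap, fun u => by rw [← hT, ← he]; rfl⟩
end

theorem qrpK_one : qrpK k 1 = 0 := by
  by_cases c2 : Nat.card k = 2
  · exact (two_case c2).2 1
  by_cases c3 : Nat.card k = 3
  · obtain ⟨e, he1, he⟩ := three_case c3
    simpa using he1 1 rfl
  · obtain ⟨e, he⟩ := big_case c2 c3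
    obtain ⟨a, b, h1, h2, h3, h4, h5⟩ := ex_two c2 c3
    have := he 1
    rw [← pF_unit, Units.val_one, datF.one a b h1 h2 h3 h4 h5] at this
    simpa using this

theorem qK_span (ck : qRPK k) (hck2 : Nat.card k = 2 → ck ≠ 0) (P : Submodule (RF k) (qRPK k))
    (hP : ∀ u, qrpK k u ∈ P) (hP2 : Nat.card k = 2 → ck ∈ P) (m : qRPK k) : m ∈ P := by
  by_cases c2 : Nat.card k = 2
  · obtain ⟨⟨e, he⟩, hq⟩ := two_case (k := k) c2
    have hz : ∀ z w : ZMod 3, z ≠ 0 → w = 0 ∨ w = z ∨ w = -z := by decide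
    have hne : e ck ≠ 0 := by simpa using hck2 c2
    rcases hz (e ck) (e m) hne with h | h | h
    · have : m = 0 := by simpa using h
      rw [this]; exact P.zero_mem
    · rw [e.injective h]; exact hP2 c2
    · rw [← map_neg] at h
      rw [e.injective h]; exact P.neg_mem (hP2 c2)
  by_cases c3 : Nat.card k = 3
  · obtain ⟨e, he1, he⟩ := three_case c3
    obtain ⟨a, ha0, ha1⟩ := ex_one c2
    obtain ⟨r, hr⟩ := q3_surj (e m)
    have h := he (U k a ha0) ha1
    have h' : e m = e (r • qrpK k (U k a ha0)) := by
      rw [map_smul, h, ← hr, ← map_smul, smul_eq_mul, mul_one]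
    rw [e.injective h']
    exact P.smul_mem _ (hP _)
  · obtain ⟨e, he⟩ := big_case c2 c3
    have : P.map e.toLinearMap = ⊤ := by
      rw [eq_top_iff, ← qRP_span, Submodule.span_le]
      rintro _ ⟨u, rfl⟩
      exact ⟨qrpK k u, hP u, he u⟩
    have h : e m ∈ P.map e.toLinearMap := by rw [this]; trivial
    obtain ⟨m', hm', hh⟩ := h
    rw [← e.injective hh]; exact hm'
end
end S5
end

noncomputable section
namespace S5
section
variable {F : Type} [Field F] {Γ₀ : Type} [LinearOrderedCommGroupWithZero Γ₀]
variable {v : Valuation F Γ₀}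

theorem v_of_u1 {u : F} (hu : v (u - 1) < 1) : v u = 1 := by
  have := v.map_one_add_of_lt hu
  simpa using this

theorem u1_mul {a b : F} (ha : v (a - 1) < 1) (hb : v (b - 1) < 1) : v (a * b - 1) < 1 := by
  have e : a * b - 1 = a * (b - 1) + (a - 1) := by ring
  rw [e]
  refine lt_of_le_of_lt (v.map_add _ _) (max_lt ?_ ha)
  rw [map_mul, v_of_u1 ha, one_mul]; exact hb

theorem v_le_sub {x : F} (h : 1 ≤ v (1 - x)) : v x ≤ v (1 - x) := by
  have e : x = 1 - (1 - x) := by ring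
  calc v x = v (1 - (1 - x)) := by rw [← e]
    _ ≤ max (v 1) (v (1 - x)) := v.map_sub _ _
    _ = v (1 - x) := by rw [map_one]; exact max_eq_right h

variable {M : Type} [AddCommGroup M] [Module (RF F) M] {p : F → M}

theorem p_congr (D : Dat F M p) (hU : ∀ u : F, v (u - 1) < 1 → p u = 0) {x y : F}
    (h : v (y - x) < v x) : p x = p y := by
  have hx0 : x ≠ 0 := by rintro rfl; simp at h
  have hvx : 0 < v x := v.pos_iff.2 hx0
  have hr : v (y / x - 1) < 1 := by
    have : y / x - 1 = (y - x) / x := by field_simp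
    rw [this, map_div₀]; exact (div_lt_one₀ hvx).2 h
  have hy0 : y ≠ 0 := by
    rintro rfl
    simp at hr
  by_cases hx1 : v (x - 1) < 1
  · rw [hU x hx1, hU y]
    have := u1_mul hr hx1
    rwa [div_mul_cancel₀ _ hx0] at this
  · rw [not_lt, Valuation.map_sub_swap] at hx1
    have hxv := v_le_sub hx1
    have hlt : v (y - x) < v (1 - x) := lt_of_lt_of_le h hxv
    have hy1 : v (1 - y) = v (1 - x) := by
      have e : 1 - y = (1 - x) - (y - x) := by ring
      rw [e]
      exact Valuation.map_sub_eq_of_lt_left v hlt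
    have p0 : 0 < v (1 - x) := lt_of_lt_of_le zero_lt_one hx1
    have nx : 1 - x ≠ 0 := v.pos_iff.1 p0
    have ny : 1 - y ≠ 0 := v.pos_iff.1 (hy1 ▸ p0)
    have hs : v ((1 - x) / (1 - y) - 1) < 1 := by
      have : (1 - x) / (1 - y) - 1 = (y - x) / (1 - y) := by field_simp; ring
      rw [this, map_div₀, hy1]; exact (div_lt_one₀ p0).2 hlt
    have ht : (1 - x⁻¹) / (1 - y⁻¹) = (y / x) * ((1 - x) / (1 - y)) := by
      have h3 : 1 - x⁻¹ = -(1 - x) / x := by field_simp; ring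
      have h4 : 1 - y⁻¹ = -(1 - y) / y := by field_simp; ring
      rw [h3, h4]; field_simp
    have A := D.five x y hx0 (by rintro rfl; simp at nx) hy0 (by rintro rfl; simp at ny)
    rw [ht, hU _ hr, hU _ hs, hU _ (u1_mul hr hs)] at A
    simp only [smul_zero, add_zero, sub_zero] at A
    exact sub_eq_zero.1 A

structure DatC (v : Valuation F Γ₀) (p : F → M) (C : M) : Prop where
  D : Dat F M p
  hU : ∀ u : F, v (u - 1) < 1 → p u = 0
  hC : ∀ x : F, x ≠ 0 → x ≠ 1 → C = p x + sg F (-1) • p (1 - x)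
  hm : sg F (-1) • C = C
  h3 : C + C + C = 0
  hspan : ∀ P : Submodule (RF F) M, (∀ x : F, x ≠ 0 → p x ∈ P) → P = ⊤

variable {C : M}

theorem DatC.pos (E : DatC v p C) {x : F} (h0 : x ≠ 0) (h : v x < 1) : p x = C := by
  have h1 : x ≠ 1 := by rintro rfl; simp at h
  rw [E.hC x h0 h1, E.hU (1 - x), smul_zero, add_zero]
  have : 1 - x - 1 = -x := by ring
  rwa [this, Valuation.map_neg]

theorem DatC.neg (E : DatC v p C) {x : F} (h : 1 < v x) : p x = -C := by
  have h0 : x ≠ 0 := by rintro rfl; simp at h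
  have := E.D.psi x h0
  rw [E.pos (inv_ne_zero h0) (by rw [map_inv₀]; exact inv_lt_one_of_one_lt₀ h), E.hm] at this
  exact eq_neg_of_add_eq_zero_left this

theorem DatC.u1 (E : DatC v p C) {u : F} (hu : v (u - 1) < 1) (m : M) : sg F u • m = m := by
  by_cases hu1 : u = 1
  · rw [hu1, sg_one, one_smul]
  have hvu := v_of_u1 hu
  have hu0 : u ≠ 0 := by rintro rfl; simp at hvu
  have hpi : 1 - u ≠ 0 := sub_ne_zero.2 (Ne.symm hu1)
  have hvpi : v (1 - u) < 1 := by rwa [Valuation.map_sub_swap]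
  have key : ∀ y : F, y ≠ 0 → 1 ≤ v (1 - y) →
      sg F u • p y - p y = sg F (1 - u) • (sg F u • C - C) := by
    intro y hy0 hy
    have p0 : 0 < v (1 - y) := lt_of_lt_of_le zero_lt_one hy
    have ny : 1 - y ≠ 0 := v.pos_iff.1 p0
    have A := E.D.five u y hu0 hu1 hy0 (by rintro rfl; simp at ny)
    have ht : (1 - u⁻¹) / (1 - y⁻¹) = (y / u) * ((1 - u) / (1 - y)) := by
      have h3 : 1 - u⁻¹ = -(1 - u) / u := by field_simp; ring
      have h4 : 1 - y⁻¹ = -(1 - y) / y := by field_simp; ring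
      rw [h3, h4]; field_simp
    have c1 : p y = p (y / u) := by
      apply p_congr E.D E.hU
      have : y / u - y = y / u * (1 - u) := by field_simp
      rw [this, map_mul, map_div₀, hvu, div_one]
      exact mul_lt_of_lt_one_right (v.pos_iff.2 hy0) hvpi
    have c2 : p ((1 - u) / (1 - y)) = C := by
      apply E.pos (div_ne_zero hpi ny)
      rw [map_div₀]
      exact (div_lt_one₀ p0).2 (lt_of_lt_of_le hvpi hy)
    have c3 : p ((1 - u⁻¹) / (1 - y⁻¹)) = C := by
      rw [ht]
      apply E.pos (mul_ne_zero (div_ne_zero hy0 hu0) (div_ne_zero hpi ny))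
      rw [map_mul, map_div₀, map_div₀, hvu, div_one, ← mul_div_assoc]
      apply (div_lt_one₀ p0).2
      exact lt_of_lt_of_le (mul_lt_of_lt_one_right (v.pos_iff.2 hy0) hvpi) (v_le_sub hy)
    rw [E.hU u hu, ← c1, c2, c3, sg_inv_sub hu0] at A
    linear_combination (norm := module) A
  have hd : sg F u • C - C = 0 := by
    have hinv : 1 < v (1 - u)⁻¹ := by
      rw [map_inv₀]; exact (one_lt_inv₀ (v.pos_iff.2 hpi)).2 hvpi
    have k1 := key (1 - u) hpi (by rw [sub_sub_cancel, hvu])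
    have k2 := key (1 - u)⁻¹ (inv_ne_zero hpi) (by
      rw [Valuation.map_sub_eq_of_lt_right v (by rw [map_one]; exact hinv)]
      exact hinv.le)
    rw [E.pos hpi hvpi] at k1
    rw [E.neg hinv, ← k1] at k2
    have h3 := E.h3
    have h3' := congrArg (fun m => sg F u • m) h3
    simp only [smul_add, smul_zero] at h3'
    linear_combination (norm := module) h3' - h3 + k2
  have all : ∀ y : F, y ≠ 0 → sg F u • p y = p y := by
    intro y hy0
    by_cases hy : v (y - 1) < 1
    · rw [E.hU y hy, smul_zero]
    · rw [not_lt, Valuation.map_sub_swap] at hy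
      have := key y hy0 hy
      rw [hd, smul_zero] at this
      exact sub_eq_zero.1 this
  let P : Submodule (RF F) M := LinearMap.eqLocus (LinearMap.lsmul (RF F) M (sg F u)) LinearMap.id
  have hP : P = ⊤ := E.hspan P (fun x hx => all x hx)
  have : m ∈ P := by rw [hP]; trivial
  exact this

theorem DatC.act (E : DatC v p C) {x y : F} (hx : v x = 1) (h : v (y - x) < 1) (m : M) :
    sg F x • m = sg F y • m := by
  have hx0 : x ≠ 0 := by rintro rfl; simp at hx
  have hr : v (y / x - 1) < 1 := by
    have : y / x - 1 = (y - x) / x := by field_simp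
    rw [this, map_div₀, hx, div_one]; exact h
  have : y = x * (y / x) := by field_simp
  rw [this, sg_mul, mul_smul, E.u1 hr]

end
end S5
end

noncomputable section
namespace S5
section
variable {F : Type} [Field F] {Γ₀ : Type} [LinearOrderedCommGroupWithZero Γ₀]
variable (v : Valuation F Γ₀)

def rs : ↥v.valuationSubring →+* Resk F v := IsLocalRing.residue ↥v.valuationSubring

def lk (a : F) : Resk F v := if h : v a ≤ 1 then rs v ⟨a, h⟩ else 0

variable {v}

theorem lk_of {a : F} (h : v a ≤ 1) : lk v a = rs v ⟨a, h⟩ := dif_pos h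

theorem lk_mul {a b : F} (ha : v a ≤ 1) (hb : v b ≤ 1) : lk v (a * b) = lk v a * lk v b := by
  have hab : v (a * b) ≤ 1 := by rw [map_mul]; exact mul_le_one' ha hb
  rw [lk_of ha, lk_of hb, lk_of hab, ← map_mul]; rfl

theorem v_sub_le {a b : F} (ha : v a ≤ 1) (hb : v b ≤ 1) : v (a - b) ≤ 1 :=
  (v.map_sub a b).trans (max_le ha hb)

theorem lk_sub {a b : F} (ha : v a ≤ 1) (hb : v b ≤ 1) : lk v (a - b) = lk v a - lk v b := by
  rw [lk_of ha, lk_of hb, lk_of (v_sub_le ha hb), ← map_sub]; rfl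

theorem lk_one : lk v (1 : F) = 1 := by
  rw [lk_of (by simp)]; exact map_one (rs v)

theorem lk_zero {a : F} (ha : v a ≤ 1) : lk v a = 0 ↔ v a < 1 := by
  rw [lk_of ha]
  have : rs v ⟨a, ha⟩ = 0 ↔ (⟨a, ha⟩ : v.valuationSubring) ∈
      IsLocalRing.maximalIdeal v.valuationSubring := IsLocalRing.residue_eq_zero_iff _
  rw [this, IsLocalRing.mem_maximalIdeal, mem_nonunits_iff]
  constructor
  · intro h
    refine lt_of_le_of_ne ha fun h1 => h ?_
    have h0 : a ≠ 0 := by rintro rfl; simp at h1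
    exact (unitOfVal F v (Units.mk0 a h0) h1).isUnit
  · rintro h ⟨u, hu⟩
    have h1 : ((u : v.valuationSubring) : F) * ((u⁻¹ : (v.valuationSubring)ˣ) : v.valuationSubring) = 1 := by
      rw [← MulMemClass.coe_mul, Units.mul_inv]; rfl
    have h2 := congrArg v h1
    rw [hu, map_mul, map_one] at h2
    have h3 : v (((u⁻¹ : (v.valuationSubring)ˣ) : v.valuationSubring) : F) ≤ 1 :=
      ((u⁻¹ : (v.valuationSubring)ˣ) : v.valuationSubring).2
    exact (mul_lt_one_of_lt_of_le h h3).ne h2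

theorem lk_ne {a : F} (ha : v a = 1) : lk v a ≠ 0 := by
  rw [Ne, lk_zero ha.le, ha]; simp

theorem lk_eq {a b : F} (ha : v a ≤ 1) (hb : v b ≤ 1) : lk v a = lk v b ↔ v (a - b) < 1 := by
  rw [← lk_zero (v_sub_le ha hb), lk_sub ha hb, sub_eq_zero]

theorem lk_inv {a : F} (ha : v a = 1) : lk v a⁻¹ = (lk v a)⁻¹ := by
  have h0 : a ≠ 0 := by rintro rfl; simp at ha
  apply eq_inv_of_mul_eq_one_left
  rw [← lk_mul (by rw [map_inv₀, ha, inv_one]) ha.le, inv_mul_cancel₀ h0, lk_one]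

theorem lk_surj (c : Resk F v) : ∃ a : F, v a ≤ 1 ∧ lk v a = c := by
  obtain ⟨⟨a, ha⟩, h⟩ := IsLocalRing.residue_surjective (R := v.valuationSubring) c
  exact ⟨a, ha, (lk_of ha).trans h⟩

def lft (c : Resk F v) : F := (lk_surj c).choose
theorem lft_le (c : Resk F v) : v (lft c) ≤ 1 := (lk_surj c).choose_spec.1
theorem lk_lft (c : Resk F v) : lk v (lft c) = c := (lk_surj c).choose_spec.2
theorem v_lft {c : Resk F v} (h : c ≠ 0) : v (lft c) = 1 := by
  refine le_antisymm (lft_le c) (not_lt.1 fun h' => h ?_)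
  rw [← lk_lft c, lk_zero (lft_le c)]; exact h'

theorem resUnit_val (x : Fˣ) (hx : v (x : F) = 1) :
    ((resUnit F v x hx : (Resk F v)ˣ) : Resk F v) = lk v (x : F) := (lk_of hx.le).symm

variable {M : Type} [AddCommGroup M] [Module (RF F) M] {p : F → M} {C : M}

theorem DatC.act' (E : DatC v p C) {x y : F} (hx : v x = 1) (hy : v y = 1)
    (h : lk v x = lk v y) (m : M) : sg F x • m = sg F y • m :=
  E.act hx (by rw [Valuation.map_sub_swap]; exact (lk_eq hx.le hy.le).1 h) m

theorem DatC.congr' (E : DatC v p C) {x y : F} (hx : v x = 1) (hy : v y = 1)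
    (h : lk v x = lk v y) : p x = p y :=
  p_congr E.D E.hU (by rw [Valuation.map_sub_swap, hx]; exact (lk_eq hx.le hy.le).1 h)

theorem DatC.exRho (E : DatC v p C) : ∃ ρ : RF (Resk F v) →+* Module.End (RF F) M,
    ∀ (x : F), v x = 1 → ∀ m, ρ (sg _ (lk v x)) m = sg F x • m := by
  let f : (Resk F v)ˣ →* Module.End (RF F) M :=
    { toFun := fun w => LinearMap.lsmul (RF F) M (sg F (lft (w : Resk F v)))
      map_one' := by
        ext m
        show sg F _ • m = m
        rw [← one_smul (RF F) m, ← sg_one, smul_smul, ← sg_mul, mul_one]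
        apply E.act' (v_lft (by simp)) (by simp)
        rw [lk_lft, lk_one]; rfl
      map_mul' := by
        intro a b
        ext m
        show sg F _ • m = sg F _ • sg F _ • m
        rw [smul_smul, ← sg_mul]
        have ha := v_lft a.ne_zero
        have hb := v_lft b.ne_zero
        apply E.act' (v_lft (Units.ne_zero _)) (by rw [map_mul, ha, hb, one_mul])
        rw [lk_lft, lk_mul ha.le hb.le, lk_lft, lk_lft]; rfl }
  have hf : ∀ x ∈ (powMonoidHom 2 : (Resk F v)ˣ →* (Resk F v)ˣ).range, f x = 1 := by
    rintro _ ⟨w, rfl⟩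
    rw [powMonoidHom_apply, map_pow, pow_two]
    ext m
    show sg F _ • sg F _ • m = m
    have hw := v_lft w.ne_zero
    rw [smul_smul, sg_sq, one_smul]
    intro h
    rw [h] at hw; simp at hw
  let g : SqCl (Resk F v) →* Module.End (RF F) M := QuotientGroup.lift _ f hf
  refine ⟨(MonoidAlgebra.lift ℤ (Module.End (RF F) M) (SqCl (Resk F v)) g : RF (Resk F v) →ₐ[ℤ] Module.End (RF F) M).toRingHom, ?_⟩
  intro x hx m
  rw [sg_of (lk_ne hx)]
  have : (MonoidAlgebra.lift ℤ (Module.End (RF F) M) (SqCl (Resk F v)) g : RF (Resk F v) →ₐ[ℤ] Module.End (RF F) M).toRingHom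
    (cls _ (U _ (lk v x) (lk_ne hx))) = f (U _ (lk v x) (lk_ne hx)) := by
    show MonoidAlgebra.lift ℤ (Module.End (RF F) M) (SqCl (Resk F v)) g (MonoidAlgebra.of ℤ _ _) = _
    rw [MonoidAlgebra.lift_of]; rfl
  rw [this]
  show sg F _ • m = _
  apply E.act' (v_lft (Units.ne_zero _)) hx
  rw [lk_lft]; rfl

theorem DatC.exT (E : DatC v p C) (ρ : RF (Resk F v) →+* Module.End (RF F) M)
    (hρ : ∀ (x : F), v x = 1 → ∀ m, ρ (sg _ (lk v x)) m = sg F x • m)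
    (ck : qRPK (Resk F v))
    (hck : ∀ (u : (Resk F v)ˣ) (hu : (u : Resk F v) ≠ 1),
      ck = qrpK _ u +
        cls (Resk F v) (-1) • qrpK _ (U (Resk F v) (1 - (u : Resk F v)) (one_sub_ne hu)))
    (hck2 : Nat.card (Resk F v) = 2 → ck ≠ 0) :
    ∃ T : qRPK (Resk F v) →+ M, (∀ r m, T (r • m) = ρ r (T m)) ∧
      (∀ (x : Fˣ) (hx : v (x : F) = 1), T (qrpK _ (resUnit F v x hx)) = p x) ∧ T ck = C := by
  letI inst : Module (RF (Resk F v)) M := Module.compHom M ρ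
  have hs : ∀ (x : F), v x = 1 → ∀ m : M, sg (Resk F v) (lk v x) • m = sg F x • m := hρ
  have hm1 : ∀ m : M, sg (Resk F v) (-1) • m = sg F (-1) • m := by
    intro m
    have h1 : v (-1 : F) = 1 := by rw [Valuation.map_neg, map_one]
    rw [← hs (-1) h1]
    have e : lk v (-1 : F) = -1 := by
      have := lk_sub (v := v) (a := 0) (b := 1) (by simp) (by simp)
      rw [zero_sub, lk_one, (lk_zero (v := v) (a := 0) (by simp)).2 (by simp), zero_sub] at this
      exact this
    rw [e]
  have hp : ∀ (c : Resk F v) (x : F), v x = 1 → lk v x = c → p (lft c) = p x := by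
    rintro _ x hx rfl
    exact E.congr' (v_lft (lk_ne hx)) hx (lk_lft _)
  have v1 : ∀ x : F, v x ≤ 1 → lk v x ≠ 0 → v x = 1 := fun x h h' =>
    le_antisymm h (not_lt.1 fun h'' => h' ((lk_zero h).2 h''))
  have Dk : Dat (Resk F v) M (fun c => p (lft c)) := by
    constructor
    · intro a b ha0 ha1 hb0 hb1
      have hx := v_lft ha0
      have hy := v_lft hb0
      have lx := lk_lft a
      have ly := lk_lft b
      show p (lft a) - p (lft b) + _ • p _ - _ • p _ + _ • p _ = 0
      generalize lft a = x at *
      generalize lft b = y at *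
      subst lx ly
      have hx0 : x ≠ 0 := by rintro rfl; simp at hx
      have hy0 : y ≠ 0 := by rintro rfl; simp at hy
      have hx1 : x ≠ 1 := by rintro rfl; exact ha1 lk_one
      have hy1 : y ≠ 1 := by rintro rfl; exact hb1 lk_one
      have l1x : lk v (1 - x) = 1 - lk v x := by rw [lk_sub (by simp) hx.le, lk_one]
      have l1y : lk v (1 - y) = 1 - lk v y := by rw [lk_sub (by simp) hy.le, lk_one]
      have hxi : v x⁻¹ = 1 := by rw [map_inv₀, hx, inv_one]
      have hyi : v y⁻¹ = 1 := by rw [map_inv₀, hy, inv_one]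
      have lxi : lk v (1 - x⁻¹) = 1 - (lk v x)⁻¹ := by
        rw [lk_sub (by simp) hxi.le, lk_one, lk_inv hx]
      have lyi : lk v (1 - y⁻¹) = 1 - (lk v y)⁻¹ := by
        rw [lk_sub (by simp) hyi.le, lk_one, lk_inv hy]
      have lxi' : lk v (x⁻¹ - 1) = (lk v x)⁻¹ - 1 := by
        rw [lk_sub hxi.le (by simp), lk_one, lk_inv hx]
      have na : 1 - lk v x ≠ 0 := sub_ne_zero.2 (Ne.symm ha1)
      have nb : 1 - lk v y ≠ 0 := sub_ne_zero.2 (Ne.symm hb1)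
      have nai : (lk v x)⁻¹ - 1 ≠ 0 := sub_ne_zero.2 fun h => ha1 (inv_eq_one.1 h)
      have nai' : 1 - (lk v x)⁻¹ ≠ 0 := sub_ne_zero.2 fun h => ha1 (inv_eq_one.1 h.symm)
      have nbi : 1 - (lk v y)⁻¹ ≠ 0 := sub_ne_zero.2 fun h => hb1 (inv_eq_one.1 h.symm)
      have w1 := v1 (1 - x) (v_sub_le (by simp) hx.le) (by rw [l1x]; exact na)
      have w2 := v1 (1 - y) (v_sub_le (by simp) hy.le) (by rw [l1y]; exact nb)
      have w3 := v1 (1 - x⁻¹) (v_sub_le (by simp) hxi.le) (by rw [lxi]; exact nai')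
      have w4 := v1 (1 - y⁻¹) (v_sub_le (by simp) hyi.le) (by rw [lyi]; exact nbi)
      have w5 := v1 (x⁻¹ - 1) (v_sub_le hxi.le (by simp)) (by rw [lxi']; exact nai)
      have vdiv : ∀ a b : F, v a = 1 → v b = 1 → v (a / b) = 1 := by
        intro a b ha hb; rw [map_div₀, ha, hb, div_one]
      have ldiv : ∀ a b : F, v a = 1 → v b = 1 → lk v (a / b) = lk v a / lk v b := by
        intro a b ha hb
        rw [div_eq_mul_inv, lk_mul ha.le (by rw [map_inv₀, hb, inv_one]), lk_inv hb,
          div_eq_mul_inv]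
      rw [hp _ (y / x) (vdiv _ _ hy hx) (ldiv _ _ hy hx),
        hp _ ((1 - x⁻¹) / (1 - y⁻¹)) (vdiv _ _ w3 w4) (by rw [ldiv _ _ w3 w4, lxi, lyi]),
        hp _ ((1 - x) / (1 - y)) (vdiv _ _ w1 w2) (by rw [ldiv _ _ w1 w2, l1x, l1y]),
        ← lxi', ← l1x, hs x hx, hs _ w5, hs _ w1]
      exact E.D.five x y hx0 hx1 hy0 hy1
    · intro a ha0
      have hx := v_lft ha0
      have lx := lk_lft a
      show p (lft a) + _ • p _ = 0
      generalize lft a = x at *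
      subst lx
      have hx0 : x ≠ 0 := by rintro rfl; simp at hx
      rw [hm1, hp _ x⁻¹ (by rw [map_inv₀, hx, inv_one]) (lk_inv hx)]
      exact E.D.psi x hx0
  have h1 : p (lft (1 : Resk F v)) = 0 := by
    rw [hp _ 1 (by simp) lk_one]
    exact E.hU 1 (by simp)
  obtain ⟨T, hT, hTc⟩ := qlift Dk h1 C E.h3 (by
    intro a ha0 ha1
    have hx := v_lft ha0
    have lx := lk_lft a
    show C = p (lft a) + _ • p _
    generalize lft a = x at *
    subst lx
    have hx0 : x ≠ 0 := by rintro rfl; simp at hx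
    have hx1 : x ≠ 1 := by rintro rfl; exact ha1 lk_one
    have l1x : lk v (1 - x) = 1 - lk v x := by rw [lk_sub (by simp) hx.le, lk_one]
    have na : 1 - lk v x ≠ 0 := sub_ne_zero.2 (Ne.symm ha1)
    have w1 := v1 (1 - x) (v_sub_le (by simp) hx.le) (by rw [l1x]; exact na)
    rw [hm1, hp _ (1 - x) w1 l1x]
    exact E.hC x hx0 hx1) ck hck hck2
  refine ⟨T.toAddMonoidHom, fun r m => T.map_smul r m, fun x hx => ?_, hTc⟩
  show T _ = _
  rw [hT]
  exact hp _ _ hx (resUnit_val x hx).symm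
end
end S5
end

noncomputable section
namespace S5
section
variable {F : Type} [Field F] {Γ₀ : Type} [LinearOrderedCommGroupWithZero Γ₀]
variable {v : Valuation F Γ₀}
variable {N : Type} [AddCommGroup N] [Module (RF (Resk F v)) N]

theorem ind_induction {P : IndMod F v N → Prop} (h0 : P 0) (h1 : ∀ r m, P (indE F v N r m))
    (h2 : ∀ x y, P x → P y → P (x + y)) (z : IndMod F v N) : P z := by
  letI : Module (ZU F v) (RF F) := Module.compHom _ (zuF F v)
  letI : Module (ZU F v) N := Module.compHom _ (zuK F v)
  exact TensorProduct.induction_on (motive := P) z h0 h1 h2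

theorem smul_indE (s r : RF F) (m : N) : s • indE F v N r m = indE F v N (s * r) m := rfl

theorem indE_add (r : RF F) (m m' : N) :
    indE F v N r (m + m') = indE F v N r m + indE F v N r m' := by
  letI : Module (ZU F v) (RF F) := Module.compHom _ (zuF F v)
  letI : Module (ZU F v) N := Module.compHom _ (zuK F v)
  exact TensorProduct.tmul_add _ _ _

theorem indE_zero (r : RF F) : indE F v N r 0 = 0 := by
  letI : Module (ZU F v) (RF F) := Module.compHom _ (zuF F v)
  letI : Module (ZU F v) N := Module.compHom _ (zuK F v)
  exact TensorProduct.tmul_zero _ _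

theorem indE_bal (a : ZU F v) (r : RF F) (m : N) :
    indE F v N (zuF F v a * r) m = indE F v N r (zuK F v a • m) := by
  letI : Module (ZU F v) (RF F) := Module.compHom _ (zuF F v)
  letI : Module (ZU F v) N := Module.compHom _ (zuK F v)
  exact TensorProduct.smul_tmul a r m

theorem ind_lift {P : Type} [AddCommGroup P] (f : RF F →+ N →+ P)
    (hf : ∀ (a : ZU F v) r m, f (zuF F v a * r) m = f r (zuK F v a • m)) :
    ∃ T : IndMod F v N →+ P, ∀ r m, T (indE F v N r m) = f r m := by
  letI : Module (ZU F v) (RF F) := Module.compHom _ (zuF F v)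
  letI : Module (ZU F v) N := Module.compHom _ (zuK F v)
  exact ⟨TensorProduct.liftAddHom f hf, fun r m => rfl⟩

theorem zuK_surj : Function.Surjective (zuK F v) := by
  intro r
  have hs : Function.Surjective ((sqc (Resk F v)).comp (uvToResUnits F v)) := by
    intro c
    obtain ⟨w, rfl⟩ := QuotientGroup.mk_surjective c
    have hx := v_lft (v := v) w.ne_zero
    have h0 : lft (w : Resk F v) ≠ 0 := by intro h; rw [h] at hx; simp at hx
    refine ⟨unitOfVal F v (Units.mk0 _ h0) hx, ?_⟩
    show sqc _ (resUnit F v (Units.mk0 _ h0) hx) = sqc _ w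
    congr 1
    ext
    exact (resUnit_val _ _).trans (lk_lft _)
  induction r using MonoidAlgebra.induction_on with
  | of g =>
    obtain ⟨u, rfl⟩ := hs g
    refine ⟨(MonoidAlgebra.of ℤ (Uv F v) u : MonoidAlgebra ℤ (Uv F v)), ?_⟩
    show MonoidAlgebra.mapDomainRingHom ℤ _ (MonoidAlgebra.of ℤ (Uv F v) u) = _
    simp
  | add f g hf hg =>
    obtain ⟨a, rfl⟩ := hf
    obtain ⟨b, rfl⟩ := hg
    exact ⟨a + b, map_add _ _ _⟩
  | smul n f hf =>
    obtain ⟨a, rfl⟩ := hf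
    exact ⟨n • a, map_zsmul _ _ _⟩

theorem zu_induction {P : ZU F v → Prop} (a : ZU F v)
    (h1 : ∀ u : Uv F v, P (MonoidAlgebra.of ℤ (Uv F v) u : MonoidAlgebra ℤ (Uv F v)))
    (h2 : ∀ a b, P a → P b → P (a + b)) (h3 : ∀ (n : ℤ) a, P a → P (n • a)) : P a :=
  MonoidAlgebra.induction_on (motive := P) a h1 h2 h3

theorem zuF_of (u : Uv F v) :
    zuF F v (MonoidAlgebra.of ℤ (Uv F v) u : MonoidAlgebra ℤ (Uv F v)) =
      cls F (uvToUnits F v u) := by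
  show MonoidAlgebra.mapDomainRingHom ℤ _ (MonoidAlgebra.of ℤ (Uv F v) u) = _
  simp [cls]

theorem zuK_of (u : Uv F v) :
    zuK F v (MonoidAlgebra.of ℤ (Uv F v) u : MonoidAlgebra ℤ (Uv F v)) =
      cls _ (uvToResUnits F v u) := by
  show MonoidAlgebra.mapDomainRingHom ℤ _ (MonoidAlgebra.of ℤ (Uv F v) u) = _
  simp [cls]

theorem v_uv (u : Uv F v) : v (uvToUnits F v u : F) = 1 := by
  have h1 : v (uvToUnits F v u : F) ≤ 1 := (u.val).2
  have h2 : v ((uvToUnits F v u)⁻¹ : Fˣ) ≤ 1 := by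
    rw [← map_inv]; exact ((u⁻¹).val).2
  refine le_antisymm h1 (not_lt.1 fun h => ?_)
  rw [Units.val_inv_eq_inv_val, map_inv₀] at h2
  exact absurd ((one_lt_inv₀ (v.pos_iff.2 (Units.ne_zero _))).2 h) (not_lt.2 h2)

theorem lk_uv (u : Uv F v) : ((uvToResUnits F v u : (Resk F v)ˣ) : Resk F v) =
    lk v (uvToUnits F v u : F) := (lk_of (v_uv u).le).symm

end

section
variable {F : Type} [Field F] {Γ₀ : Type} [LinearOrderedCommGroupWithZero Γ₀]

theorem U1V_val {v : Valuation F Γ₀} {u : Fˣ} (h : u ∈ U1V F v) : v (u : F) = 1 := v_of_u1 h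

theorem datQ (hcard : 4 ≤ Cardinal.mk F) (v : Valuation F Γ₀) :
    ∃ C, DatC v (fun a => (KvV F v).mkQ (pF F a)) C := by
  have h2 : ¬ Nat.card F = 2 := by
    intro h
    have : Finite F := Nat.finite_of_card_ne_zero (by omega)
    rw [← Nat.cast_card, h] at hcard
    have : (4 : ℕ) ≤ 2 := by exact_mod_cast hcard
    omega
  obtain ⟨a, ha0, ha1⟩ := ex_one h2
  have D : Dat F (qRP F ⧸ KvV F v) (fun a => (KvV F v).mkQ (pF F a)) := by
    constructor
    · intro x y a b c d
      have := congrArg (KvV F v).mkQ (datF.five x y a b c d)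
      simpa only [map_add, map_sub, map_smul, map_zero] using this
    · intro x a
      have := congrArg (KvV F v).mkQ (datF.psi x a)
      simpa only [map_add, map_sub, map_smul, map_zero] using this
  obtain ⟨C, hC, hm, h3⟩ := D.exC a ha0 ha1
  refine ⟨C, D, ?_, hC, hm, h3, ?_⟩
  · intro u hu
    have h0 : u ≠ 0 := by rintro rfl; simp at hu
    rw [pF_of h0]
    exact (Submodule.Quotient.mk_eq_zero _).2 (Submodule.subset_span ⟨_, hu, rfl⟩)
  · intro P hP
    have h : P.comap (KvV F v).mkQ = ⊤ := by
      rw [eq_top_iff, ← qRP_span, Submodule.span_le]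
      rintro _ ⟨u, rfl⟩
      have := hP u u.ne_zero
      rw [pF_unit] at this
      exact this
    rw [eq_top_iff]
    rintro z -
    obtain ⟨w, rfl⟩ := Submodule.mkQ_surjective _ z
    have : w ∈ P.comap (KvV F v).mkQ := by rw [h]; trivial
    exact this

theorem exT' (hcard : 4 ≤ Cardinal.mk F) (v : Valuation F Γ₀)
    (ck : qRPK (Resk F v))
    (hck : ∀ (u : (Resk F v)ˣ) (hu : (u : Resk F v) ≠ 1),
      ck = qrpK _ u +
        cls (Resk F v) (-1) • qrpK _ (U (Resk F v) (1 - (u : Resk F v)) (one_sub_ne hu)))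
    (hck2 : Nat.card (Resk F v) = 2 → ck ≠ 0) :
    ∃ T : IndMod F v (qRPK (Resk F v)) →ₗ[RF F] (qRP F ⧸ KvV F v),
      (∀ (x : Fˣ) (hx : v (x : F) = 1),
        T (indE F v _ 1 (qrpK _ (resUnit F v x hx))) = (KvV F v).mkQ (qrp F x)) ∧
      (∀ x : Fˣ, v (x : F) < 1 → T (indE F v _ 1 ck) = (KvV F v).mkQ (qrp F x)) ∧
      (∀ x : Fˣ, 1 < v (x : F) → T (- indE F v _ 1 ck) = (KvV F v).mkQ (qrp F x)) := by
  obtain ⟨C, E⟩ := datQ hcard v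
  obtain ⟨ρ, hρ⟩ := E.exRho
  obtain ⟨T, hT, hT1, hTc⟩ := E.exT ρ hρ ck hck hck2
  have hbal : ∀ (a : ZU F v) (m : qRP F ⧸ KvV F v), zuF F v a • m = ρ (zuK F v a) m := by
    intro a
    induction a using zu_induction with
    | h1 u =>
      intro m
      rw [zuF_of, zuK_of, ← sg_unit, ← sg_unit, lk_uv, hρ _ (v_uv u)]
    | h2 a b ha hb =>
      intro m
      rw [map_add, map_add, map_add, add_smul, ha, hb]; rfl
    | h3 n a ha =>
      intro m
      rw [map_zsmul, map_zsmul, map_zsmul, smul_assoc, ha]; rfl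
  let f : RF F →+ qRPK (Resk F v) →+ (qRP F ⧸ KvV F v) :=
    AddMonoidHom.mk' (fun r => AddMonoidHom.mk' (fun m => r • T m) (by
      intro m m'; rw [map_add, smul_add])) (by
      intro r r'; ext m; exact add_smul r r' (T m))
  have hfa : ∀ r m, f r m = r • T m := fun r m => rfl
  obtain ⟨L, hL⟩ := ind_lift (v := v) f (by
    intro a r m
    rw [hfa, hfa, hT, ← hbal, smul_smul, mul_comm])
  let L' : IndMod F v (qRPK (Resk F v)) →ₗ[RF F] (qRP F ⧸ KvV F v) :=
    { toFun := L
      map_add' := map_add L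
      map_smul' := by
        intro s z
        induction z using ind_induction with
        | h0 => simp
        | h1 r m => rw [smul_indE, hL, hL, hfa, hfa, mul_smul]; rfl
        | h2 x y hx hy => rw [smul_add, map_add, map_add, hx, hy, smul_add] }
  have hL' : ∀ m, L' (indE F v _ 1 m) = T m := by
    intro m
    show L _ = _
    rw [hL, hfa, one_smul]
  refine ⟨L', fun x hx => ?_, fun x hx => ?_, fun x hx => ?_⟩
  · rw [hL', hT1, pF_unit]
  · rw [hL', hTc, ← pF_unit]; exact (E.pos x.ne_zero hx).symm
  · rw [map_neg, hL', hTc, ← pF_unit]; exact (E.neg hx).symm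

theorem ex_pos (hcard : 4 ≤ Cardinal.mk F) (v : Valuation F Γ₀)
    (h : Nat.card (Resk F v) = 2) : ∃ x : Fˣ, v (x : F) < 1 := by
  by_contra! hc
  have h1 : ∀ x : F, x ≠ 0 → v x = 1 := by
    intro x hx
    refine le_antisymm ?_ (hc (Units.mk0 x hx))
    have := hc (Units.mk0 x hx)⁻¹
    rw [Units.val_inv_eq_inv_val, map_inv₀] at this
    exact not_lt.1 fun h' => absurd (inv_lt_one_of_one_lt₀ h') (not_lt.2 this)
  have hle : ∀ x : F, v x ≤ 1 := by
    intro x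
    by_cases hx : x = 0
    · simp [hx]
    · exact (h1 x hx).le
  have inj : Function.Injective (lk v) := by
    intro x y hxy
    by_contra hne
    rw [lk_eq (hle x) (hle y), h1 _ (sub_ne_zero.2 hne)] at hxy
    simp at hxy
  have h4 := hcard.trans (Cardinal.mk_le_of_injective inj)
  have : Finite (Resk F v) := Nat.finite_of_card_ne_zero (by omega)
  rw [← Nat.cast_card, h] at h4
  have : (4 : ℕ) ≤ 2 := by exact_mod_cast h4
  omega
end
end S5
end

/-- Let `F` be a field with at least `4` elements and `v` a valuation
on `F` (surjective, with values in a totally ordered abelian group with zero `Γ₀`)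
with residue field `k`.  Then the sequence
`0 → K_v → qRP(F) → Ind_F^k qRP(k) → 0`, where the second map is the specialization
homomorphism `S_v`, is a short exact sequence of `R_F`-modules; i.e. `S_v` is
surjective with kernel exactly `K_v`.  Here `S_v` is determined by
`S_v([x]) = 1 ⊗ [x̄]` if `v(x) = 1`, `S_v([x]) = 1 ⊗ C_k` if `v(x) < 1`, and
`S_v([x]) = -(1 ⊗ C_k)` if `v(x) > 1`, and `C_k` is characterized by the hypotheses
`hck` (`C_k = [u] + ⟨-1⟩[1-u]` for `u ≠ 1`) and `hck2` (if `|k| = 2` then `C_k` is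
the distinguished generator of `qRP(F₂) = ℤ/3`). -/
theorem statement5 (F : Type) [Field F] (hcard : 4 ≤ Cardinal.mk F)
    {Γ₀ : Type} [LinearOrderedCommGroupWithZero Γ₀] (v : Valuation F Γ₀)
    (hsurj : Function.Surjective v)
    (ck : qRPK (Resk F v))
    (hck : ∀ (u : (Resk F v)ˣ) (hu : (u : Resk F v) ≠ 1),
      ck = qrpK _ u +
        cls (Resk F v) (-1) • qrpK _ (U (Resk F v) (1 - (u : Resk F v)) (one_sub_ne hu)))
    (hck2 : Nat.card (Resk F v) = 2 → ck ≠ 0)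
    (S : qRP F →ₗ[RF F] IndMod F v (qRPK (Resk F v)))
    (hS1 : ∀ (x : Fˣ) (hx : v (x : F) = 1),
      S (qrp F x) = indE F v _ 1 (qrpK _ (resUnit F v x hx)))
    (hSpos : ∀ x : Fˣ, v (x : F) < 1 → S (qrp F x) = indE F v _ 1 ck)
    (hSneg : ∀ x : Fˣ, 1 < v (x : F) → S (qrp F x) = -indE F v _ 1 ck) :
    LinearMap.ker S = KvV F v ∧ Function.Surjective S := by
  obtain ⟨T, hT1, hTp, hTn⟩ := S5.exT' hcard v ck hck hck2
  have hTS : T.comp S = (KvV F v).mkQ := by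
    have : LinearMap.eqLocus (T.comp S) (KvV F v).mkQ = ⊤ := by
      rw [eq_top_iff, ← S5.qRP_span, Submodule.span_le]
      rintro _ ⟨x, rfl⟩
      show T (S (qrp F x)) = _
      rcases lt_trichotomy (v (x : F)) 1 with h | h | h
      · rw [hSpos x h]; exact hTp x h
      · rw [hS1 x h]; exact hT1 x h
      · rw [hSneg x h]; exact hTn x h
    exact (LinearMap.eqLocus_eq_top).1 this
  refine ⟨le_antisymm ?_ ?_, ?_⟩
  · intro z hz
    have h := LinearMap.congr_fun hTS z
    rw [LinearMap.comp_apply, LinearMap.mem_ker.1 hz, map_zero] at h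
    exact (Submodule.Quotient.mk_eq_zero _).1 h.symm
  · unfold KvV
    rw [Submodule.span_le]
    rintro _ ⟨u, hu, rfl⟩
    show S (qrp F u) = 0
    have hv := S5.U1V_val hu
    rw [hS1 u hv]
    have : resUnit F v u hv = 1 := by
      ext
      rw [S5.resUnit_val, Units.val_one, ← S5.lk_one (v := v)]
      exact (S5.lk_eq hv.le (by simp)).2 hu
    rw [this, S5.qrpK_one, S5.indE_zero]
  · have key : ∀ m : qRPK (Resk F v), ∀ r : RF F, indE F v _ r m ∈ LinearMap.range S := by
      let P : Submodule (RF (Resk F v)) (qRPK (Resk F v)) :=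
        { carrier := {m | ∀ r : RF F, indE F v _ r m ∈ LinearMap.range S}
          add_mem' := by
            intro a b ha hb r
            rw [S5.indE_add]; exact Submodule.add_mem _ (ha r) (hb r)
          zero_mem' := by
            intro r; rw [S5.indE_zero]; exact Submodule.zero_mem _
          smul_mem' := by
            intro c m hm r
            obtain ⟨a, rfl⟩ := S5.zuK_surj c
            rw [← S5.indE_bal]; exact hm _ }
      have h1 : ∀ m, indE F v _ 1 m ∈ LinearMap.range S → m ∈ P := by
        intro m hm r
        have := Submodule.smul_mem _ r hm
        rwa [S5.smul_indE, mul_one] at this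
      intro m
      refine S5.qK_span ck hck2 P (fun u => h1 _ ?_) (fun h2 => h1 _ ?_) m
      · have hx := S5.v_lft (v := v) u.ne_zero
        have h0 : S5.lft (u : Resk F v) ≠ 0 := by intro h; rw [h] at hx; simp at hx
        have hu : resUnit F v (Units.mk0 _ h0) hx = u := by
          ext
          exact (S5.resUnit_val _ _).trans (S5.lk_lft _)
        refine ⟨qrp F (Units.mk0 _ h0), ?_⟩
        rw [hS1 _ hx, hu]
      · obtain ⟨x, hx⟩ := S5.ex_pos hcard v h2
        exact ⟨qrp F x, hSpos x hx⟩
    intro z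
    have : z ∈ LinearMap.range S := by
      induction z using S5.ind_induction with
      | h0 => exact Submodule.zero_mem _
      | h1 r m => exact key m r
      | h2 x y hx hy => exact Submodule.add_mem _ hx hy
    exact this
end
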